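/- arXiv:1812.05482 — 3 statements merged into one kernel-verified Lean document; each statement's English description precedes it below -/
import Mathlib

section
/- (Horn–Loewner) Let f : (0, ∞) → ℝ be continuous, fix a positive integer n, and suppose that f[A] is positive semidefinite for every positive semidefinite n × n real matrix A with entries in (0, ∞). Then f is (n−3)-times continuously differentiable on (0, ∞), f^(k)(x) ≥ 0 for all x ∈ (0, ∞) and all 0 ≤ k ≤ n−3, and f^(n−3) is convex and non-decreasing on (0, ∞). Furthermore, if f is (n−1)-times continuously differentiable on (0, ∞), then f^(k)(x) ≥ 0 for all x ∈ (0, ∞) and all 0 ≤ k ≤ n−1. -/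
open Set Filter Topology

namespace HornLoewner

/-- Entrywise preservation of positive semidefiniteness, in quadratic-form shape. -/
def Pres (n : ℕ) (f : ℝ → ℝ) : Prop :=
  ∀ A : Matrix (Fin n) (Fin n) ℝ, A.PosSemidef → (∀ j k, 0 < A j k) → (A.map f).PosSemidef

lemma psd_add_const {n : ℕ} {A : Matrix (Fin n) (Fin n) ℝ} (hA : A.PosSemidef) {s t : ℝ}
    (hs : 0 ≤ s) (ht : 0 ≤ t) (u : Fin n → ℝ) :
    (A + s • Matrix.vecMulVec 1 1 + t • Matrix.vecMulVec u u).PosSemidef := by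
  have h1 := (Matrix.posSemidef_vecMulVec_self_star (1 : Fin n → ℝ)).smul hs
  have h2 := (Matrix.posSemidef_vecMulVec_self_star u).smul ht
  simp only [star_trivial] at h1 h2
  exact (hA.add h1).add h2

lemma psd_iff_sum {n : ℕ} {A : Matrix (Fin n) (Fin n) ℝ} :
    A.PosSemidef ↔ A.IsHermitian ∧ ∀ v : Fin n → ℝ, 0 ≤ ∑ i, ∑ j, v i * v j * A i j := by
  rw [Matrix.posSemidef_iff_dotProduct_mulVec]
  refine and_congr_right fun _ => forall_congr' fun v => ?_
  have : star v ⬝ᵥ A.mulVec v = ∑ i, ∑ j, v i * v j * A i j := by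
    simp only [star_trivial, dotProduct, Matrix.mulVec, Finset.mul_sum]
    refine Finset.sum_congr rfl fun i _ => Finset.sum_congr rfl fun j _ => by ring
  rw [this]

lemma exists_vec (n m : ℕ) (hm : m < n) : ∃ v : Fin n → ℝ, ∀ k < n,
    ∑ i, v i * ((i : ℝ) + 1) ^ k = if k = m then 1 else 0 := by
  set V := Matrix.vandermonde (fun i : Fin n => (i : ℝ) + 1) with hV
  have hdet : IsUnit V.det := by
    rw [isUnit_iff_ne_zero, hV, Matrix.det_vandermonde_ne_zero_iff]
    intro i j h
    simpa [Fin.ext_iff] using h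
  refine ⟨Matrix.vecMul (Pi.single ⟨m, hm⟩ 1) V⁻¹, fun k hk => ?_⟩
  have h : Matrix.vecMul (Matrix.vecMul (Pi.single (⟨m, hm⟩ : Fin n) (1 : ℝ)) V⁻¹) V
      = Pi.single ⟨m, hm⟩ 1 := by
    rw [Matrix.vecMul_vecMul, Matrix.nonsing_inv_mul _ hdet, Matrix.vecMul_one]
  have h2 := congrFun h ⟨k, hk⟩
  rw [Pi.single_apply] at h2
  simp only [Fin.mk.injEq] at h2
  rw [← h2]
  simp [Matrix.vecMul, dotProduct, hV, Matrix.vandermonde_apply]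

lemma deriv_nonneg {n : ℕ} {f : ℝ → ℝ} (hp : Pres n f) {m : ℕ} (hm : m < n)
    (hf : ContDiffOn ℝ m f (Ioi 0)) {a : ℝ} (ha : 0 < a) :
    0 ≤ iteratedDerivWithin m f (Ioi 0) a := by
  obtain ⟨v, hv⟩ := exists_vec n m hm
  set u : Fin n → ℝ := fun i => (i : ℝ) + 1 with hu
  have hupos : ∀ i, 0 < u i := fun i => by positivity
  set T := taylorWithinEval f m (Ioi 0) a with hT
  set c : ℕ → ℝ := fun k => (k.factorial : ℝ)⁻¹ * iteratedDerivWithin k f (Ioi 0) a with hc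
  have hTe : ∀ w, T (a + w) = ∑ k ∈ Finset.range (m + 1), c k * w ^ k := by
    intro w
    rw [hT, taylor_within_apply]
    refine Finset.sum_congr rfl fun k _ => ?_
    simp [hc]; ring
  have hq : ∀ t > 0, 0 ≤ ∑ i, ∑ j, v i * v j * f (a + t * (u i * u j)) := by
    intro t ht
    have h := psd_add_const (Matrix.PosSemidef.zero (n := Fin n) (R := ℝ)) ha.le ht.le u
    have h2 := (psd_iff_sum.1 (hp _ h ?_)).2 v
    · simpa [Matrix.vecMulVec_apply] using h2
    · intro j k
      have := mul_pos ht (mul_pos (hupos j) (hupos k))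
      simp [Matrix.vecMulVec_apply]; positivity
  have hmain : ∀ t, ∑ i, ∑ j, v i * v j * T (a + t * (u i * u j)) = c m * t ^ m := by
    intro t
    have e1 : ∀ i j, v i * v j * T (a + t * (u i * u j)) =
        ∑ k ∈ Finset.range (m + 1), c k * t ^ k * ((v i * u i ^ k) * (v j * u j ^ k)) := by
      intro i j
      rw [hTe, Finset.mul_sum]
      refine Finset.sum_congr rfl fun k _ => by ring
    simp_rw [e1]
    have e2 : ∀ i, ∑ j, ∑ k ∈ Finset.range (m + 1),
        c k * t ^ k * ((v i * u i ^ k) * (v j * u j ^ k)) =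
        ∑ k ∈ Finset.range (m + 1), c k * t ^ k * ((v i * u i ^ k) * ∑ j, (v j * u j ^ k)) := by
      intro i
      rw [Finset.sum_comm]
      simp_rw [Finset.mul_sum]
    simp_rw [e2]
    rw [Finset.sum_comm]
    have e3 : ∀ k ∈ Finset.range (m + 1),
        ∑ i, c k * t ^ k * ((v i * u i ^ k) * ∑ j, (v j * u j ^ k)) =
        if k = m then c k * t ^ k else 0 := by
      intro k hk
      rw [← Finset.mul_sum, ← Finset.sum_mul, hv k (by have := Finset.mem_range.1 hk; omega)]
      split_ifs <;> simp
    rw [Finset.sum_congr rfl e3]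
    simp
  have hlo := taylor_isLittleO (convex_Ioi (0 : ℝ)) (mem_Ioi.2 ha) hf
  have hterm : ∀ i j, Tendsto (fun t : ℝ => (f (a + t * (u i * u j)) - T (a + t * (u i * u j)))
      / t ^ m) (𝓝[>] 0) (𝓝 0) := by
    intro i j
    have hw := mul_pos (hupos i) (hupos j)
    set w := u i * u j
    have ht : Tendsto (fun t : ℝ => a + t * w) (𝓝[>] 0) (𝓝[Ioi 0] a) := by
      refine tendsto_nhdsWithin_iff.2 ⟨?_, ?_⟩
      · have : Continuous (fun t : ℝ => a + t * w) := by fun_prop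
        have := this.tendsto 0
        simp only [zero_mul, add_zero] at this
        exact this.mono_left nhdsWithin_le_nhds
      · filter_upwards [self_mem_nhdsWithin] with t ht
        have := mul_pos (mem_Ioi.1 ht) hw
        exact mem_Ioi.2 (by positivity)
    have h1 := hlo.comp_tendsto ht
    have h2 : (fun t : ℝ => f (a + t * w) - T (a + t * w)) =o[𝓝[>] 0] fun t => t ^ m := by
      refine h1.trans_isBigO ?_
      refine Asymptotics.IsBigO.of_bound (w ^ m) (Eventually.of_forall fun t => ?_)
      simp [mul_pow, abs_of_pos hw, mul_comm]
    exact h2.tendsto_div_nhds_zero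
  have hlim : Tendsto (fun t : ℝ => c m + ∑ i, ∑ j, v i * v j *
      ((f (a + t * (u i * u j)) - T (a + t * (u i * u j))) / t ^ m)) (𝓝[>] 0)
      (𝓝 (c m + ∑ i, ∑ j, v i * v j * 0)) :=
    tendsto_const_nhds.add (tendsto_finsetSum _ fun i _ => tendsto_finsetSum _ fun j _ =>
      (hterm i j).const_mul _)
  simp only [mul_zero, Finset.sum_const_zero, add_zero] at hlim
  have hcm : 0 ≤ c m := by
    refine ge_of_tendsto hlim ?_
    filter_upwards [self_mem_nhdsWithin] with t ht
    have ht : 0 < t := ht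
    have e : c m + ∑ i, ∑ j, v i * v j *
      ((f (a + t * (u i * u j)) - T (a + t * (u i * u j))) / t ^ m) =
      (∑ i, ∑ j, v i * v j * f (a + t * (u i * u j))) / t ^ m := by
      have : c m = (∑ i, ∑ j, v i * v j * T (a + t * (u i * u j))) / t ^ m := by
        rw [hmain]; field_simp
      rw [this]
      simp_rw [Finset.sum_div]
      rw [← Finset.sum_add_distrib]
      refine Finset.sum_congr rfl fun i _ => ?_
      rw [← Finset.sum_add_distrib]
      refine Finset.sum_congr rfl fun j _ => ?_
      ring
    rw [e]
    exact div_nonneg (hq t ht) (by positivity)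
  have hfac : (0 : ℝ) < (m.factorial : ℝ)⁻¹ := by positivity
  exact (mul_nonneg_iff_of_pos_left hfac).1 hcm

lemma mvt {g g1 : ℝ → ℝ} (h : ∀ x > 0, HasDerivAt g (g1 x) x) {x y : ℝ} (hx : 0 < x)
    (hxy : x ≤ y) : ∃ z, x ≤ z ∧ z ≤ y ∧ g y - g x = g1 z * (y - x) := by
  rcases hxy.eq_or_lt with rfl | hlt
  · exact ⟨x, le_rfl, le_rfl, by simp⟩
  · obtain ⟨z, hz, e⟩ := exists_hasDerivAt_eq_slope g g1 hlt
      (fun w hw => (h w (hx.trans_le hw.1)).continuousAt.continuousWithinAt)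
      (fun w hw => h w (hx.trans hw.1))
    refine ⟨z, hz.1.le, hz.2.le, ?_⟩
    rw [e, div_mul_cancel₀ _ (sub_pos.2 hlt).ne']

lemma mono_of {g g1 : ℝ → ℝ} (h : ∀ x > 0, HasDerivAt g (g1 x) x) (h1 : ∀ x > 0, 0 ≤ g1 x)
    {x y : ℝ} (hx : 0 < x) (hxy : x ≤ y) : g x ≤ g y := by
  obtain ⟨z, hz, -, e⟩ := mvt h hx hxy
  have := mul_nonneg (h1 z (hx.trans_le hz)) (sub_nonneg.2 hxy)
  linarith

lemma estimate {g g1 g2 g3 : ℝ → ℝ} (h : ∀ x > 0, HasDerivAt g (g1 x) x)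
    (h1 : ∀ x > 0, HasDerivAt g1 (g2 x) x) (h2 : ∀ x > 0, HasDerivAt g2 (g3 x) x)
    (p0 : ∀ x > 0, 0 ≤ g x) (p1 : ∀ x > 0, 0 ≤ g1 x) (p2 : ∀ x > 0, 0 ≤ g2 x)
    (p3 : ∀ x > 0, 0 ≤ g3 x) {x y b : ℝ} (hx : 0 < x) (hy : 0 < y) (hxb : x ≤ b) (hyb : y ≤ b) :
    |g y - g x - g1 x * (y - x)| ≤ g (b + 2) * (y - x) ^ 2 := by
  have hb : 0 < b := hx.trans_le hxb
  have hB : g2 b ≤ g (b + 2) := by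
    obtain ⟨z, hz, hz', e⟩ := mvt h1 hb (by linarith : b ≤ b + 1)
    obtain ⟨w, hw, hw', e'⟩ := mvt h (by linarith : 0 < b + 1) (by linarith : b + 1 ≤ b + 2)
    have := mono_of h2 p3 hb hz
    have := mono_of h1 p2 (by linarith : 0 < b + 1) hw
    have := p1 b hb
    have := p0 (b + 1) (by linarith)
    have e1 : b + 1 - b = 1 := by ring
    have e2 : b + 2 - (b + 1) = 1 := by ring
    rw [e1] at e
    rw [e2] at e'
    linarith
  have key : ∀ p q, 0 < p → p ≤ q → q ≤ b → 0 ≤ g1 q - g1 p ∧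
      g1 q - g1 p ≤ g (b + 2) * (q - p) := by
    intro p q hp hpq hqb
    obtain ⟨z, hz, hz', e⟩ := mvt h1 hp hpq
    have a1 := p2 z (hp.trans_le hz)
    have a2 := mono_of h2 p3 (hp.trans_le hz) (hz'.trans hqb)
    have a3 := sub_nonneg.2 hpq
    rw [e]
    exact ⟨mul_nonneg a1 a3, mul_le_mul_of_nonneg_right (a2.trans hB) a3⟩
  have hpos : 0 ≤ g (b + 2) := p0 _ (by linarith)
  rcases le_total x y with hxy | hxy
  · obtain ⟨z, hz, hz', e⟩ := mvt h hx hxy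
    obtain ⟨k1, k2⟩ := key x z hx hz (hz'.trans hyb)
    have e3 : g y - g x - g1 x * (y - x) = (g1 z - g1 x) * (y - x) := by rw [e]; ring
    have a3 := sub_nonneg.2 hxy
    rw [e3, abs_of_nonneg (mul_nonneg k1 a3)]
    have : g (b + 2) * (z - x) ≤ g (b + 2) * (y - x) :=
      mul_le_mul_of_nonneg_left (by linarith) hpos
    nlinarith
  · obtain ⟨z, hz, hz', e⟩ := mvt h hy hxy
    obtain ⟨k1, k2⟩ := key z x (hy.trans_le hz) hz' hxb
    have e3 : g y - g x - g1 x * (y - x) = (g1 x - g1 z) * (x - y) := by linear_combination -e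
    have a3 := sub_nonneg.2 hxy
    rw [e3, abs_of_nonneg (mul_nonneg k1 a3)]
    have : g (b + 2) * (x - z) ≤ g (b + 2) * (x - y) :=
      mul_le_mul_of_nonneg_left (by linarith) hpos
    nlinarith

lemma step {g g1 : ℕ → ℝ → ℝ} {G : ℝ → ℝ}
    (hlim : ∀ x > 0, Tendsto (fun j => g j x) atTop (𝓝 (G x)))
    (hest : ∀ j x y b, 0 < x → 0 < y → x ≤ b → y ≤ b →
      |g j y - g j x - g1 j x * (y - x)| ≤ g j (b + 2) * (y - x) ^ 2) {x : ℝ} (hx : 0 < x) :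
    ∃ l, HasDerivAt G l x ∧ Tendsto (fun j => g1 j x) atTop (𝓝 l) := by
  obtain ⟨M, hM⟩ := (hlim (x + 1 + 2) (by linarith)).bddAbove_range
  have hM' : ∀ j, g j (x + 1 + 2) ≤ |M| := fun j =>
    (hM (mem_range_self j)).trans (le_abs_self M)
  set C := |M| + 1
  have hC : 0 < C := by positivity
  have hest' : ∀ j y, 0 < y → y ≤ x + 1 →
      |g j y - g j x - g1 j x * (y - x)| ≤ C * (y - x) ^ 2 := fun j y hy hy1 =>
    (hest j x y (x + 1) hx hy (by linarith) hy1).trans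
      (mul_le_mul_of_nonneg_right ((hM' j).trans (by simp [C])) (sq_nonneg _))
  have hcau : CauchySeq fun j => g1 j x := by
    rw [Metric.cauchySeq_iff']
    intro ε hε
    set h := min 1 (ε / (4 * C))
    have hh : 0 < h := lt_min one_pos (by positivity)
    have hh1 : h ≤ 1 := min_le_left _ _
    have hhC : C * h ≤ ε / 4 := by
      have : h ≤ ε / (4 * C) := min_le_right _ _
      calc C * h ≤ C * (ε / (4 * C)) := mul_le_mul_of_nonneg_left this hC.le
        _ = ε / 4 := by field_simp
    have hd : Tendsto (fun j => (g j (x + h) - g j x) / h) atTop (𝓝 ((G (x + h) - G x) / h)) :=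
      ((hlim _ (by linarith)).sub (hlim x hx)).div_const h
    have hnear : ∀ j, |(g j (x + h) - g j x) / h - g1 j x| ≤ ε / 4 := by
      intro j
      have := hest' j (x + h) (by linarith) (by linarith)
      have e : g j (x + h) - g j x - g1 j x * (x + h - x) =
        ((g j (x + h) - g j x) / h - g1 j x) * h := by
        rw [sub_mul, div_mul_cancel₀ _ hh.ne']; ring
      rw [e, abs_mul, abs_of_pos hh] at this
      have e2 : C * (x + h - x) ^ 2 = (C * h) * h := by ring
      rw [e2] at this
      exact (le_of_mul_le_mul_right this hh).trans hhC
    obtain ⟨N, hN⟩ := (Metric.cauchySeq_iff'.1 hd.cauchySeq) (ε / 4) (by linarith)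
    refine ⟨N, fun j hj => ?_⟩
    have a1 := hN j hj
    rw [Real.dist_eq] at a1 ⊢
    have a2 := hnear j
    have a3 := hnear N
    rw [abs_lt] at *
    rw [abs_le] at *
    constructor <;> linarith [a1.1, a1.2, a2.1, a2.2, a3.1, a3.2]
  obtain ⟨l, hl⟩ := cauchySeq_tendsto_of_complete hcau
  refine ⟨l, ?_, hl⟩
  have hG : ∀ y, 0 < y → y ≤ x + 1 → |G y - G x - l * (y - x)| ≤ C * (y - x) ^ 2 := by
    intro y hy hy1
    refine le_of_tendsto' (((hlim y hy).sub (hlim x hx)).sub (hl.mul_const _)).abs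
      fun j => hest' j y hy hy1
  rw [hasDerivAt_iff_isLittleO]
  refine Asymptotics.IsBigO.trans_isLittleO (g := fun y => ‖y - x‖ ^ 2) ?_
    (Asymptotics.isLittleO_pow_sub_sub x one_lt_two)
  refine Asymptotics.IsBigO.of_bound C ?_
  filter_upwards [Ioo_mem_nhds hx (by linarith : x < x + 1)] with y hy
  have := hG y hy.1 hy.2.le
  simpa [mul_comm] using this


/-- `C^m` on `(0,∞)` with nonnegative derivatives up to order `m`. -/
def Good (m : ℕ) (g : ℝ → ℝ) : Prop :=
  ContDiffOn ℝ m g (Ioi 0) ∧ ∀ k ≤ m, ∀ x > 0, 0 ≤ iteratedDerivWithin k g (Ioi 0) x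

lemma Good.hasDerivAt {m : ℕ} {g : ℝ → ℝ} (h : Good (m + 1) g) :
    ∀ x > 0, HasDerivAt g (derivWithin g (Ioi 0) x) x := by
  intro x hx
  have h1 : DifferentiableOn ℝ g (Ioi 0) := h.1.differentiableOn (by simp)
  exact (h1 x hx).hasDerivWithinAt.hasDerivAt (Ioi_mem_nhds hx)

lemma Good.derivWithin {m : ℕ} {g : ℝ → ℝ} (h : Good (m + 1) g) :
    Good m (derivWithin g (Ioi 0)) := by
  refine ⟨?_, fun k hk x hx => ?_⟩
  · have := h.1
    rw [Nat.cast_succ, contDiffOn_succ_iff_derivWithin (uniqueDiffOn_Ioi 0)] at this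
    exact this.2.2
  · have := h.2 (k + 1) (by omega) x hx
    rwa [iteratedDerivWithin_succ'] at this

lemma Good.nonneg {m : ℕ} {g : ℝ → ℝ} (h : Good m g) : ∀ x > 0, 0 ≤ g x := by
  intro x hx
  simpa using h.2 0 (Nat.zero_le _) x hx

lemma limit_thm (m : ℕ) : ∀ (g : ℕ → ℝ → ℝ) (G : ℝ → ℝ), (∀ j, Good (m + 2) (g j)) →
    (∀ x > 0, Tendsto (fun j => g j x) atTop (𝓝 (G x))) →
    ContDiffOn ℝ m G (Ioi 0) ∧ (∀ k ≤ m, ∀ x > 0, 0 ≤ iteratedDerivWithin k G (Ioi 0) x) ∧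
    ConvexOn ℝ (Ioi 0) (iteratedDerivWithin m G (Ioi 0)) ∧
    MonotoneOn (iteratedDerivWithin m G (Ioi 0)) (Ioi 0) := by
  induction m with
  | zero =>
    intro g G hg hlim
    have hconv : ConvexOn ℝ (Ioi 0) G := by
      refine ⟨convex_Ioi 0, fun x hx y hy a b ha hb hab => ?_⟩
      have hz : a • x + b • y ∈ Ioi (0 : ℝ) := convex_Ioi 0 hx hy ha hb hab
      refine le_of_tendsto_of_tendsto' (hlim _ hz)
        (((hlim x hx).const_smul a).add ((hlim y hy).const_smul b)) fun j => ?_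
      have hc : ConvexOn ℝ (Ioi 0) (g j) := by
        have d1 := (hg j).hasDerivAt
        have d2 := (hg j).derivWithin.hasDerivAt
        refine MonotoneOn.convexOn_of_deriv (convex_Ioi 0)
          (fun z hz => (d1 z hz).continuousAt.continuousWithinAt) ?_ ?_
        · rw [interior_Ioi]
          exact fun z hz => (d1 z hz).differentiableAt.differentiableWithinAt
        · rw [interior_Ioi]
          intro p hp q hq hpq
          rw [(d1 p hp).deriv, (d1 q hq).deriv]
          exact mono_of d2 (hg j).derivWithin.derivWithin.nonneg hp hpq
      exact hc.2 hx hy ha hb hab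
    have hmono : MonotoneOn G (Ioi 0) := by
      intro p hp q hq hpq
      exact le_of_tendsto_of_tendsto' (hlim p hp) (hlim q hq) fun j =>
        mono_of (hg j).hasDerivAt (hg j).derivWithin.nonneg hp hpq
    have e : iteratedDerivWithin 0 G (Ioi 0) = G := iteratedDerivWithin_zero
    refine ⟨?_, ?_, ?_, ?_⟩
    · simpa using hconv.continuousOn isOpen_Ioi
    · intro k hk x hx
      obtain rfl : k = 0 := by omega
      rw [e]
      exact ge_of_tendsto' (hlim x hx) fun j => (hg j).nonneg x hx
    · rwa [e]
    · rwa [e]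
  | succ m ih =>
    intro g G hg hlim
    have hstep := fun (x : ℝ) (hx : 0 < x) => step (g1 := fun j => derivWithin (g j) (Ioi 0)) hlim
      (fun j x y b hx hy hxb hyb => estimate (hg j).hasDerivAt (hg j).derivWithin.hasDerivAt
        (hg j).derivWithin.derivWithin.hasDerivAt (hg j).nonneg (hg j).derivWithin.nonneg
        (hg j).derivWithin.derivWithin.nonneg (hg j).derivWithin.derivWithin.derivWithin.nonneg
        hx hy hxb hyb) hx
    have hd : DifferentiableOn ℝ G (Ioi 0) := fun x hx => by
      obtain ⟨l, h1, -⟩ := hstep x hx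
      exact h1.differentiableAt.differentiableWithinAt
    obtain ⟨c1, c2, c3, c4⟩ := ih (fun j => derivWithin (g j) (Ioi 0)) (derivWithin G (Ioi 0))
      (fun j => (hg j).derivWithin) (fun x hx => by
        obtain ⟨l, h1, h2⟩ := hstep x hx
        rwa [h1.hasDerivWithinAt.derivWithin (uniqueDiffOn_Ioi 0 x hx)])
    have e : ∀ k, iteratedDerivWithin (k + 1) G (Ioi 0) =
        iteratedDerivWithin k (derivWithin G (Ioi 0)) (Ioi 0) :=
      fun k => iteratedDerivWithin_succ'
    refine ⟨?_, ?_, ?_, ?_⟩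
    · rw [Nat.cast_succ, contDiffOn_succ_iff_derivWithin (uniqueDiffOn_Ioi 0)]
      exact ⟨hd, by simp, c1⟩
    · intro k hk x hx
      cases k with
      | zero =>
        rw [iteratedDerivWithin_zero]
        exact ge_of_tendsto' (hlim x hx) fun j => (hg j).nonneg x hx
      | succ k =>
        rw [e]
        exact c2 k (by omega) x hx
    · rwa [e]
    · rwa [e]

/-- Forward averaging. -/
noncomputable def S (h : ℝ) (f : ℝ → ℝ) (x : ℝ) : ℝ := ∫ s in (0 : ℝ)..1, f (x + h * s)

lemma intble {f : ℝ → ℝ} (hf : ContinuousOn f (Ioi 0)) {h x : ℝ} (hh : 0 < h) (hx : 0 < x) :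
    IntervalIntegrable (fun s => f (x + h * s)) MeasureTheory.volume 0 1 := by
  apply ContinuousOn.intervalIntegrable
  refine hf.comp (by fun_prop) ?_
  intro s hs
  rw [uIcc_of_le zero_le_one] at hs
  have := mul_nonneg hh.le hs.1
  exact mem_Ioi.2 (by linarith)

lemma S_hasDerivAt {f : ℝ → ℝ} (hf : ContinuousOn f (Ioi 0)) {h : ℝ} (hh : 0 < h) :
    ∀ x > 0, HasDerivAt (S h f) (h⁻¹ * (f (x + h) - f x)) x := by
  intro x hx
  have hint : ∀ a b, 0 < a → 0 < b → IntervalIntegrable f MeasureTheory.volume a b := by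
    intro a b ha hb
    apply ContinuousOn.intervalIntegrable
    exact hf.mono fun z hz => (lt_min ha hb).trans_le hz.1
  have hF : ∀ z > 0, HasDerivAt (fun y => ∫ s in x..y, f s) (f z) z := by
    intro z hz
    refine intervalIntegral.integral_hasDerivAt_right (hint x z hx hz) ?_
      (hf.continuousAt (Ioi_mem_nhds hz))
    exact hf.stronglyMeasurableAtFilter isOpen_Ioi z hz
  have h1 : HasDerivAt (fun y => h⁻¹ * ((∫ s in x..(y + h), f s) - ∫ s in x..y, f s))
      (h⁻¹ * (f (x + h) - f x)) x :=
    (((hF (x + h) (by linarith)).comp_add_const x h).sub (hF x hx)).const_mul _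
  refine h1.congr_of_eventuallyEq ?_
  filter_upwards [Ioi_mem_nhds hx] with y hy
  have hy : 0 < y := hy
  rw [intervalIntegral.integral_interval_sub_left (hint _ _ hx (by linarith)) (hint _ _ hx hy)]
  have := intervalIntegral.mul_integral_comp_add_mul (a := 0) (b := 1) (f := f) h y
  simp only [mul_zero, add_zero, mul_one] at this
  rw [← this, S]
  field_simp

lemma S_cont {f : ℝ → ℝ} (hf : ContinuousOn f (Ioi 0)) {h : ℝ} (hh : 0 < h) :
    ContinuousOn (S h f) (Ioi 0) := fun x hx =>
  (S_hasDerivAt hf hh x hx).continuousAt.continuousWithinAt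

lemma S_contDiff {f : ℝ → ℝ} {h : ℝ} (hh : 0 < h) {m : ℕ} (hf : ContDiffOn ℝ m f (Ioi 0)) :
    ContDiffOn ℝ (m + 1 : ℕ) (S h f) (Ioi 0) := by
  have hd := S_hasDerivAt hf.continuousOn hh
  rw [Nat.cast_succ, contDiffOn_succ_iff_derivWithin (uniqueDiffOn_Ioi 0)]
  refine ⟨fun x hx => (hd x hx).differentiableAt.differentiableWithinAt, by simp, ?_⟩
  have : ContDiffOn ℝ m (fun x => h⁻¹ * (f (x + h) - f x)) (Ioi 0) := by
    refine contDiffOn_const.mul (ContDiffOn.sub ?_ hf)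
    refine hf.comp (by fun_prop) fun x hx => ?_
    exact mem_Ioi.2 (by have : 0 < x := hx; linarith)
  exact this.congr fun x hx =>
    (hd x hx).hasDerivWithinAt.derivWithin (uniqueDiffOn_Ioi 0 x hx)

lemma S_pres {n : ℕ} {f : ℝ → ℝ} (hf : ContinuousOn f (Ioi 0)) {h : ℝ} (hh : 0 < h)
    (hp : Pres n f) : Pres n (S h f) := by
  intro A hA hpos
  rw [psd_iff_sum]
  refine ⟨?_, fun v => ?_⟩
  · ext i j
    have : A j i = A i j := by simpa using hA.1.apply i j
    simp [this]
  · have e : ∑ i, ∑ j, v i * v j * (A.map (S h f)) i j =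
        ∫ s in (0 : ℝ)..1, ∑ i, ∑ j, v i * v j * f (A i j + h * s) := by
      have hi : ∀ i j, IntervalIntegrable (fun s => v i * v j * f (A i j + h * s))
          MeasureTheory.volume 0 1 := fun i j => (intble hf hh (hpos i j)).const_mul _
      rw [intervalIntegral.integral_finsetSum]
      · refine Finset.sum_congr rfl fun i _ => ?_
        rw [intervalIntegral.integral_finsetSum]
        · refine Finset.sum_congr rfl fun j _ => ?_
          rw [intervalIntegral.integral_const_mul]
          rfl
        · exact fun j _ => hi i j
      · intro i _
        have e2 : (fun s => ∑ j, v i * v j * f (A i j + h * s)) =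
            ∑ j, fun s => v i * v j * f (A i j + h * s) := by
          ext s; simp
        rw [e2]
        exact IntervalIntegrable.sum Finset.univ (fun j _ => hi i j)
    rw [e]
    refine intervalIntegral.integral_nonneg zero_le_one fun s hs => ?_
    have hs' : 0 ≤ h * s := mul_nonneg hh.le hs.1
    have h1 := psd_add_const hA hs' le_rfl (0 : Fin n → ℝ)
    have h2 := (psd_iff_sum.1 (hp _ h1 ?_)).2 v
    · simpa [Matrix.vecMulVec_apply] using h2
    · intro i j
      have := hpos i j
      simp [Matrix.vecMulVec_apply]; linarith

lemma S_iter {n : ℕ} {f : ℝ → ℝ} (hf : ContinuousOn f (Ioi 0)) {h : ℝ} (hh : 0 < h)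
    (hp : Pres n f) (m : ℕ) :
    ContDiffOn ℝ m ((S h)^[m] f) (Ioi 0) ∧ Pres n ((S h)^[m] f) := by
  induction m with
  | zero => exact ⟨by simpa using hf, hp⟩
  | succ m ih =>
    rw [Function.iterate_succ_apply']
    exact ⟨S_contDiff hh ih.1, S_pres ih.1.continuousOn hh ih.2⟩

lemma S_close {n : ℕ} {f : ℝ → ℝ} (hf : ContinuousOn f (Ioi 0)) {h : ℝ} (hh : 0 < h)
    (hp : Pres n f) {c ε : ℝ} (m : ℕ) : ∀ x > 0, (∀ y, x ≤ y → y ≤ x + m * h → |f y - c| ≤ ε) →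
    |(S h)^[m] f x - c| ≤ ε := by
  induction m with
  | zero => intro x hx H; exact H x le_rfl (by simp)
  | succ m ih =>
    intro x hx H
    rw [Function.iterate_succ_apply']
    set g := (S h)^[m] f with hg
    have hgc : ContinuousOn g (Ioi 0) := (S_iter hf hh hp m).1.continuousOn
    have e : S h g x - c = ∫ s in (0 : ℝ)..1, (g (x + h * s) - c) := by
      rw [intervalIntegral.integral_sub (intble hgc hh hx) (by simp)]
      simp [S]
    rw [e]
    have := intervalIntegral.norm_integral_le_of_norm_le_const (a := 0) (b := 1) (C := ε)
      (f := fun s => g (x + h * s) - c) ?_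
    · simpa using this
    · intro s hs
      rw [uIoc_of_le zero_le_one] at hs
      have h1 : 0 ≤ h * s := mul_nonneg hh.le hs.1.le
      have h2 : h * s ≤ h := by nlinarith [hs.2]
      refine ih (x + h * s) (by linarith) fun y hy hy' => H y (by linarith) ?_
      push_cast
      linarith

lemma S_tendsto {n : ℕ} {f : ℝ → ℝ} (hf : ContinuousOn f (Ioi 0))
    (hp : Pres n f) (m : ℕ) : ∀ x > 0,
    Tendsto (fun j : ℕ => (S (1 / ((j : ℝ) + 1)))^[m] f x) atTop (𝓝 (f x)) := by
  intro x hx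
  rw [Metric.tendsto_nhds]
  intro ε hε
  have hc := hf.continuousAt (Ioi_mem_nhds hx)
  obtain ⟨δ, hδ, H⟩ := Metric.continuousAt_iff.1 hc (ε / 2) (by linarith)
  have ht : Tendsto (fun j : ℕ => (m : ℝ) * (1 / ((j : ℝ) + 1))) atTop (𝓝 (m * 0)) :=
    tendsto_one_div_add_atTop_nhds_zero_nat.const_mul _
  rw [mul_zero] at ht
  filter_upwards [ht.eventually (gt_mem_nhds hδ)] with j hj
  have := S_close hf (h := 1 / ((j : ℝ) + 1)) (by positivity) hp (c := f x) (ε := ε / 2) m x hx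
    fun y hy hy' => by
      have := H (x := y) (by rw [Real.dist_eq, abs_of_nonneg (by linarith)]; linarith)
      rw [Real.dist_eq] at this
      exact this.le
  rw [Real.dist_eq]
  linarith

end HornLoewner


/-- The Horn–Loewner theorem: a continuous `f : (0,∞) → ℝ` preserving positive
semidefiniteness entrywise on `P_n((0,∞))` is `C^{n-3}` on `(0,∞)` with
non-negative derivatives of orders `0, …, n−3`, and `f^{(n−3)}` is convex and
non-decreasing; moreover if `f` is `C^{n-1}`, then `f^{(k)} ≥ 0` on `(0,∞)`
for `0 ≤ k ≤ n−1`. -/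
theorem stmt7 (f : ℝ → ℝ) (hf : ContinuousOn f (Set.Ioi (0 : ℝ)))
    (n : ℕ) (hn : 1 ≤ n)
    (hpres : ∀ A : Matrix (Fin n) (Fin n) ℝ, A.PosSemidef →
      (∀ j k, 0 < A j k) → (A.map f).PosSemidef) :
    (3 ≤ n →
      ContDiffOn ℝ ((n - 3 : ℕ) : ℕ∞) f (Set.Ioi (0 : ℝ)) ∧
      (∀ k ≤ n - 3, ∀ x ∈ Set.Ioi (0 : ℝ),
        0 ≤ iteratedDerivWithin k f (Set.Ioi (0 : ℝ)) x) ∧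
      ConvexOn ℝ (Set.Ioi (0 : ℝ))
        (iteratedDerivWithin (n - 3) f (Set.Ioi (0 : ℝ))) ∧
      MonotoneOn (iteratedDerivWithin (n - 3) f (Set.Ioi (0 : ℝ)))
        (Set.Ioi (0 : ℝ))) ∧
    (ContDiffOn ℝ ((n - 1 : ℕ) : ℕ∞) f (Set.Ioi (0 : ℝ)) →
      ∀ k ≤ n - 1, ∀ x ∈ Set.Ioi (0 : ℝ),
        0 ≤ iteratedDerivWithin k f (Set.Ioi (0 : ℝ)) x) := by
  refine ⟨fun h3 => ?_, fun hc k hk x hx => ?_⟩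
  · obtain ⟨m, rfl⟩ : ∃ m, n = m + 3 := ⟨n - 3, by omega⟩
    refine HornLoewner.limit_thm m (fun j => (HornLoewner.S (1 / ((j : ℝ) + 1)))^[m + 2] f) f
      (fun j => ?_) (HornLoewner.S_tendsto hf hpres (m + 2))
    obtain ⟨h1, h2⟩ := HornLoewner.S_iter hf (h := 1 / ((j : ℝ) + 1)) (by positivity) hpres (m + 2)
    exact ⟨h1, fun k hk x hx => HornLoewner.deriv_nonneg h2 (by omega)
      (h1.of_le (by exact_mod_cast hk)) hx⟩
  · exact HornLoewner.deriv_nonneg hpres (by omega) (hc.of_le (by exact_mod_cast hk)) hx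
end

section
/- Let 0 < ρ ≤ ∞ and I = (−ρ, ρ), and let f : I → ℝ. The following are equivalent: (1) f[A] is positive semidefinite for every n ≥ 1 and every A ∈ P_n(I); (2) f[A] is positive semidefinite for every n ≥ 1 and every Hankel matrix A ∈ P_n(I) of rank at most 3; (3) there exist coefficients c_k ≥ 0 for all k ≥ 0 such that f(x) = Σ_{k=0}^∞ c_k x^k for all x ∈ I, with the series converging on I. -/
open scoped ENNReal

section helpers

open Polynomial

/-- the functional `p ↦ ∑ p_k s_k` attached to a sequence. -/
noncomputable def LL (s : ℕ → ℝ) : ℝ[X] →ₗ[ℝ] ℝ :=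
  Polynomial.lsum (fun k => s k • LinearMap.id)

lemma LL_apply (s : ℕ → ℝ) (p : ℝ[X]) : LL s p = ∑ k ∈ p.support, p.coeff k * s k := by
  simp [LL, Polynomial.lsum_apply, Polynomial.sum_def, mul_comm]

lemma LL_range (s : ℕ → ℝ) (p : ℝ[X]) (n : ℕ) (hn : p.natDegree < n) :
    LL s p = ∑ k ∈ Finset.range n, p.coeff k * s k := by
  rw [LL_apply]
  apply Finset.sum_subset
  · intro k hk
    exact Finset.mem_range.2 (lt_of_le_of_lt (le_natDegree_of_mem_supp _ hk) hn)
  · intro k _ hk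
    simp [notMem_support_iff.1 hk]

lemma LL_X_pow (s : ℕ → ℝ) (k : ℕ) : LL s (X ^ k) = s k := by
  rw [LL_range s _ (k+1) (by simp)]
  simp [coeff_X_pow]

lemma LL_C_mul (s : ℕ → ℝ) (a : ℝ) (p : ℝ[X]) : LL s (C a * p) = a * LL s p := by
  rw [← smul_eq_C_mul, map_smul, smul_eq_mul]

/-- positive on squares and bounded under shifts -/
def PosB (L : ℝ[X] →ₗ[ℝ] ℝ) : Prop :=
  (∀ q : ℝ[X], 0 ≤ L (q * q)) ∧ ∀ p : ℝ[X], ∃ M : ℝ, ∀ k : ℕ, |L (X ^ k * p)| ≤ M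

lemma convex_bdd_antitone (m : ℕ → ℝ) (M : ℝ) (hb : ∀ k, |m k| ≤ M)
    (hc : ∀ k, 0 ≤ m k - 2 * m (k+1) + m (k+2)) : m 1 ≤ m 0 := by
  by_contra h
  push Not at h
  have h1 : ∀ k, m 1 - m 0 ≤ m (k+1) - m k := by
    intro k
    induction k with
    | zero => simp
    | succ k ih => have := hc k; simp only [add_assoc] at *; norm_num at *; linarith
  have h2 : ∀ k : ℕ, m 0 + k * (m 1 - m 0) ≤ m k := by
    intro k
    induction k with
    | zero => simp
    | succ k ih => have := h1 k; push_cast; linarith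
  obtain ⟨k, hk⟩ := exists_nat_gt ((M - m 0) / (m 1 - m 0))
  rw [div_lt_iff₀ (by linarith)] at hk
  have := h2 k
  have := (abs_le.1 (hb k)).2
  linarith

lemma PosB.sq {L : ℝ[X] →ₗ[ℝ] ℝ} (h : PosB L) (q : ℝ[X]) : L (X^2 * (q * q)) ≤ L (q * q) := by
  obtain ⟨M, hM⟩ := h.2 (q * q)
  have := convex_bdd_antitone (fun k => L (X^(2*k) * (q*q))) M (fun k => hM _) (by
    intro k
    have := h.1 (X^k * (1 - X^2) * q)
    have e : (X^k * (1 - X^2) * q) * (X^k * (1 - X^2) * q) =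
      X^(2*k) * (q*q) - 2 * (X^(2*(k+1)) * (q*q)) + X^(2*(k+2)) * (q*q) := by ring
    rw [e] at this
    have e2 : ∀ p : ℝ[X], L (2 * p) = 2 * L p := by
      intro p; rw [two_mul, map_add, two_mul]
    rw [map_add, map_sub, e2] at this
    exact this)
  simpa using this

lemma PosB.sq_pow {L : ℝ[X] →ₗ[ℝ] ℝ} (h : PosB L) (q : ℝ[X]) (m : ℕ) :
    L (X^(2*m) * (q * q)) ≤ L (q * q) := by
  induction m with
  | zero => simp
  | succ m ih =>
    refine le_trans (le_of_eq_of_le ?_ (h.sq (X^m * q))) (le_of_eq_of_le ?_ ih)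
    · congr 1; ring
    · congr 1; ring

/-- multiply the functional by a polynomial -/
noncomputable def mulL (r : ℝ[X]) (L : ℝ[X] →ₗ[ℝ] ℝ) : ℝ[X] →ₗ[ℝ] ℝ :=
  L.comp (LinearMap.mulLeft ℝ r)

lemma mulL_apply (r : ℝ[X]) (L : ℝ[X] →ₗ[ℝ] ℝ) (p : ℝ[X]) : mulL r L p = L (r * p) := rfl

lemma PosB.of_nonneg {L : ℝ[X] →ₗ[ℝ] ℝ} (h : PosB L) (r : ℝ[X])
    (hr : ∀ q, 0 ≤ L (r * (q * q))) : PosB (mulL r L) := by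
  refine ⟨hr, fun p => ?_⟩
  obtain ⟨M, hM⟩ := h.2 (r * p)
  refine ⟨M, fun k => ?_⟩
  rw [mulL_apply]
  convert hM k using 3
  ring

lemma PosB.one_sub_pow {L : ℝ[X] →ₗ[ℝ] ℝ} (h : PosB L) (m : ℕ) :
    PosB (mulL (1 - X^(2*m)) L) := by
  apply h.of_nonneg
  intro q
  have := h.sq_pow q m
  rw [sub_mul, one_mul, map_sub]; linarith

lemma PosB.one_add {L : ℝ[X] →ₗ[ℝ] ℝ} (h : PosB L) : PosB (mulL (1 + X) L) := by
  apply h.of_nonneg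
  intro q
  have h1 := h.sq q
  have h2 := h.1 ((1 + X) * q)
  have e : ((1 + X) * q) * ((1 + X) * q) = q * q + X * (q*q) + X * (q * q) + X^2 * (q*q) := by ring
  rw [e, map_add, map_add, map_add] at h2
  rw [add_mul, one_mul, map_add]; linarith

lemma PosB.one_sub {L : ℝ[X] →ₗ[ℝ] ℝ} (h : PosB L) : PosB (mulL (1 - X) L) := by
  apply h.of_nonneg
  intro q
  have h1 := h.sq q
  have h2 := h.1 ((1 - X) * q)
  have e : ((1 - X) * q) * ((1 - X) * q) = q * q - X * (q*q) - X * (q * q) + X^2 * (q*q) := by ring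
  rw [e, map_add, map_sub, map_sub] at h2
  rw [sub_mul, one_mul, map_sub]; linarith

lemma mulL_mulL (r r' : ℝ[X]) (L : ℝ[X] →ₗ[ℝ] ℝ) : mulL r (mulL r' L) = mulL (r' * r) L := by
  ext; simp [mulL_apply, mul_assoc]

lemma mulL_one (L : ℝ[X] →ₗ[ℝ] ℝ) : mulL 1 L = L := by
  ext; simp [mulL_apply]

lemma PosB.one_sub_pow_pow {L : ℝ[X] →ₗ[ℝ] ℝ} (h : PosB L) (m n : ℕ) :
    PosB (mulL ((1 - X^(2*m))^n) L) := by
  induction n with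
  | zero => simpa [mulL_one]
  | succ n ih =>
    have := ih.one_sub_pow m
    rwa [mulL_mulL, ← pow_succ] at this

lemma PosB.one_sub_X_pow {L : ℝ[X] →ₗ[ℝ] ℝ} (h : PosB L) (n : ℕ) :
    PosB (mulL ((1 - X)^n) L) := by
  induction n with
  | zero => simpa [mulL_one]
  | succ n ih =>
    have := ih.one_sub
    rwa [mulL_mulL, ← pow_succ] at this

lemma PosB.final_nonneg {L : ℝ[X] →ₗ[ℝ] ℝ} (h : PosB L) (m n : ℕ) :
    0 ≤ L ((1 - X^(2*m))^n * (1 + X)) ∧ 0 ≤ L ((1 - X^(2*m))^n * (1 - X)) := by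
  have h1 := (h.one_sub_pow_pow m n).one_add.1 1
  have h2 := (h.one_sub_pow_pow m n).one_sub.1 1
  rw [mulL_mulL, mulL_apply] at h1 h2
  simpa using And.intro h1 h2

lemma PosB.one_sub_nonneg {L : ℝ[X] →ₗ[ℝ] ℝ} (h : PosB L) (n : ℕ) :
    0 ≤ L ((1 - X)^n) := by
  have h1 := (h.one_sub_X_pow n).1 1
  rw [mulL_apply] at h1
  simpa using h1

lemma LL_shift_bdd (s : ℕ → ℝ) (M : ℝ) (hM : ∀ k, |s k| ≤ M) (p : ℝ[X]) :
    ∃ M' : ℝ, ∀ k : ℕ, |LL s (X ^ k * p)| ≤ M' := by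
  induction p using Polynomial.induction_on' with
  | add p q hp hq =>
    obtain ⟨A, hA⟩ := hp
    obtain ⟨B, hB⟩ := hq
    refine ⟨A + B, fun k => ?_⟩
    rw [mul_add, map_add]
    exact (abs_add_le _ _).trans (add_le_add (hA k) (hB k))
  | monomial n a =>
    refine ⟨|a| * M, fun k => ?_⟩
    rw [← C_mul_X_pow_eq_monomial, mul_left_comm, ← pow_add, LL_C_mul, LL_X_pow, abs_mul]
    exact mul_le_mul_of_nonneg_left (hM _) (abs_nonneg _)

lemma LL_one_sub_pow (s : ℕ → ℝ) (n : ℕ) :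
    LL s ((1 - X)^n) = ∑ k ∈ Finset.range (n+1), (-1)^k * (n.choose k : ℝ) * s k := by
  have e : (1 - X : ℝ[X])^n = ∑ k ∈ Finset.range (n+1), C ((-1)^k * (n.choose k : ℝ)) * X^k := by
    rw [sub_eq_neg_add, add_pow]
    refine Finset.sum_congr rfl fun k _ => ?_
    rw [neg_pow]; simp; ring
  rw [e, map_sum]
  refine Finset.sum_congr rfl fun k _ => ?_
  rw [LL_C_mul, LL_X_pow]

lemma LL_one_sub_pow_pow (s : ℕ → ℝ) (m n j : ℕ) :
    LL s ((1 - X^(2*m))^n * X^j) =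
      ∑ k ∈ Finset.range (n+1), (-1)^k * (n.choose k : ℝ) * s (2*m*k+j) := by
  have e : (1 - X^(2*m) : ℝ[X])^n * X^j =
      ∑ k ∈ Finset.range (n+1), C ((-1)^k * (n.choose k : ℝ)) * X^(2*m*k+j) := by
    rw [sub_eq_neg_add, add_pow, Finset.sum_mul]
    refine Finset.sum_congr rfl fun k _ => ?_
    rw [neg_pow, pow_add, pow_mul]; simp; ring
  rw [e, map_sum]
  refine Finset.sum_congr rfl fun k _ => ?_
  rw [LL_C_mul, LL_X_pow]

/-- the hypothesis on moment sequences of `a δ_1 + b δ_u + c δ_{-1}` -/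
def Fam (f : ℝ → ℝ) (r : ℝ) : Prop :=
  ∀ a b c u : ℝ, 0 ≤ a → 0 ≤ b → 0 ≤ c → 0 < u → u ≤ 1 → a + b + c < r →
    ∀ q : ℝ[X], 0 ≤ LL (fun k => f (a + b * u^k + c * (-1)^k)) (q * q)

lemma LL_sq (s : ℕ → ℝ) (q : ℝ[X]) : LL s (q * q) =
    ∑ i : Fin (q.natDegree + 1), ∑ j : Fin (q.natDegree + 1),
      q.coeff i * (q.coeff j * s (i + j)) := by
  have e : q * q = ∑ i ∈ Finset.range (q.natDegree + 1), ∑ j ∈ Finset.range (q.natDegree + 1),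
      C (q.coeff i) * (C (q.coeff j) * X^(i+j)) := by
    conv_lhs => rw [q.as_sum_range_C_mul_X_pow]
    rw [Finset.sum_mul_sum]
    refine Finset.sum_congr rfl fun i _ => Finset.sum_congr rfl fun j _ => ?_
    rw [pow_add]; ring
  rw [e, map_sum, Finset.sum_range]
  refine Finset.sum_congr rfl fun i _ => ?_
  rw [map_sum, Finset.sum_range]
  refine Finset.sum_congr rfl fun j _ => ?_
  rw [LL_C_mul, LL_C_mul, LL_X_pow]

lemma rank_add_le' {n : ℕ} (A B : Matrix (Fin n) (Fin n) ℝ) :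
    (A + B).rank ≤ A.rank + B.rank := by
  unfold Matrix.rank
  rw [Matrix.mulVecLin_add]
  refine (Submodule.finrank_mono (LinearMap.range_add_le _ _)).trans ?_
  exact Submodule.finrank_add_le_finrank_add_finrank _ _

lemma pow_vec_psd {n : ℕ} (b u : ℝ) (hb : 0 ≤ b) :
    (Matrix.of fun j k : Fin n => b * u^((j:ℕ)+(k:ℕ))).PosSemidef ∧
    (Matrix.of fun j k : Fin n => b * u^((j:ℕ)+(k:ℕ))).rank ≤ 1 := by
  constructor
  · have := (Matrix.posSemidef_vecMulVec_self_star (fun j : Fin n => u^(j:ℕ))).smul hb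
    convert this using 1
    ext j k
    simp [Matrix.vecMulVec_apply, pow_add]
  · have := Matrix.rank_vecMulVec_le (fun j : Fin n => b * u^(j:ℕ)) (fun j : Fin n => u^(j:ℕ))
    convert this using 1
    congr 1
    ext j k
    simp [Matrix.vecMulVec_apply, pow_add, mul_assoc]

lemma fam_abs {a b c u : ℝ} (ha : 0 ≤ a) (hb : 0 ≤ b) (hc : 0 ≤ c) (hu : 0 < u) (hu1 : u ≤ 1)
    (k : ℕ) : |a + b * u^k + c * (-1)^k| ≤ a + b + c := by
  refine (abs_add_three _ _ _).trans ?_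
  rw [abs_mul, abs_mul, abs_pow, abs_pow, abs_neg, abs_one, one_pow, abs_of_nonneg ha,
    abs_of_nonneg hb, abs_of_nonneg hc, abs_of_nonneg hu.le]
  have := pow_le_one₀ (n := k) hu.le hu1
  nlinarith

lemma fam_of_matrix (ρ : ℝ≥0∞) (f : ℝ → ℝ)
    (h : ∀ n : ℕ, 1 ≤ n → ∀ A : Matrix (Fin n) (Fin n) ℝ, A.PosSemidef →
        (∀ j k, ENNReal.ofReal |A j k| < ρ) →
        (∀ j k l m : Fin n, (j : ℕ) + (k : ℕ) = (l : ℕ) + (m : ℕ) →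
          A j k = A l m) →
        A.rank ≤ 3 → (A.map f).PosSemidef) (r : ℝ) (hr : ENNReal.ofReal r ≤ ρ) : Fam f r := by
  intro a b c u ha hb hc hu hu1 habc q
  set n := q.natDegree + 1 with hn
  set A : Matrix (Fin n) (Fin n) ℝ := (Matrix.of fun j k : Fin n => a * 1^((j:ℕ)+(k:ℕ))) +
    (Matrix.of fun j k : Fin n => b * u^((j:ℕ)+(k:ℕ))) +
    (Matrix.of fun j k : Fin n => c * (-1)^((j:ℕ)+(k:ℕ))) with hA
  have hAe : ∀ j k, A j k = a + b * u^((j:ℕ)+(k:ℕ)) + c * (-1)^((j:ℕ)+(k:ℕ)) := by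
    intro j k; simp [hA]
  obtain ⟨p1, r1⟩ := pow_vec_psd (n := n) a 1 ha
  obtain ⟨p2, r2⟩ := pow_vec_psd (n := n) b u hb
  obtain ⟨p3, r3⟩ := pow_vec_psd (n := n) c (-1) hc
  have key := h n (by omega) A ((p1.add p2).add p3) (by
      intro j k
      rw [hAe]
      refine lt_of_lt_of_le ?_ hr
      rw [ENNReal.ofReal_lt_ofReal_iff (by linarith)]
      exact (fam_abs ha hb hc hu hu1 _).trans_lt habc)
    (by intro j k l m hh; rw [hAe, hAe, hh])
    ((rank_add_le' _ _).trans (by have := rank_add_le' (Matrix.of fun j k : Fin n => a * 1^((j:ℕ)+(k:ℕ))) (Matrix.of fun j k : Fin n => b * u^((j:ℕ)+(k:ℕ))); omega))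
  have := key.dotProduct_mulVec_nonneg (fun i => q.coeff i)
  rw [LL_sq]
  refine le_of_le_of_eq this ?_
  change ∑ i : Fin n, q.coeff i * ∑ j : Fin n, f (A i j) * q.coeff j = _
  refine Finset.sum_congr rfl fun i _ => ?_
  rw [Finset.mul_sum]
  refine Finset.sum_congr rfl fun j _ => ?_
  rw [hAe]
  ring

lemma Fam.bound {f : ℝ → ℝ} {r : ℝ} (h : Fam f r) {x y : ℝ} (hxy : |x| ≤ y) (hy : y < r) :
    |f x| ≤ f y := by
  obtain ⟨h1, h2⟩ := abs_le.1 hxy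
  have key := h ((y+x)/2) 0 ((y-x)/2) 1 (by linarith) le_rfl (by linarith) one_pos le_rfl
    (by linarith)
  have e : (fun k : ℕ => f ((y+x)/2 + 0 * 1^k + (y-x)/2 * (-1)^k)) =
    fun k => if Even k then f y else f x := by
    ext k
    split_ifs with hk
    · rw [hk.neg_one_pow]; congr 1; ring
    · rw [(Nat.not_even_iff_odd.1 hk).neg_one_pow]; congr 1; ring
  rw [e] at key
  have k1 := key (1 + X)
  have k2 := key (1 - X)
  have e1 : (1 + X : ℝ[X]) * (1 + X) = X^0 + X^1 + X^1 + X^2 := by ring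
  have e2 : (1 - X : ℝ[X]) * (1 - X) = X^0 - X^1 - X^1 + X^2 := by ring
  rw [e1] at k1
  rw [e2] at k2
  simp only [map_add, map_sub, LL_X_pow] at k1 k2
  norm_num at k1 k2
  rw [abs_le]
  constructor <;> linarith

lemma Fam.posB {f : ℝ → ℝ} {r : ℝ} (h : Fam f r) {a b c u : ℝ} (ha : 0 ≤ a) (hb : 0 ≤ b)
    (hc : 0 ≤ c) (hu : 0 < u) (hu1 : u ≤ 1) (habc : a + b + c < r) :
    PosB (LL (fun k => f (a + b * u^k + c * (-1)^k))) := by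
  refine ⟨h a b c u ha hb hc hu hu1 habc, LL_shift_bdd _ (f (a + b + c)) fun k => ?_⟩
  exact h.bound (fam_abs ha hb hc hu hu1 k) habc

/-- all backward differences nonnegative on `(-∞, T)` -/
def AM (g : ℝ → ℝ) (T : ℝ) : Prop :=
  ∀ x < T, ∀ H > 0, ∀ n : ℕ,
    0 ≤ ∑ k ∈ Finset.range (n+1), (-1)^k * (n.choose k : ℝ) * g (x - k * H)

lemma Fam.am_exp {f : ℝ → ℝ} {r : ℝ} (hr : 0 < r) (h : Fam f r) :
    AM (fun x => f (Real.exp x)) (Real.log r) := by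
  intro x hx H hH n
  have hx' : Real.exp x < r := by rwa [← Real.lt_log_iff_exp_lt hr]
  have := (h.posB (a := 0) (b := Real.exp x) (c := 0) (u := Real.exp (-H)) le_rfl
    (Real.exp_pos _).le le_rfl (Real.exp_pos _) (by simpa using hH.le) (by simpa)).one_sub_nonneg n
  rw [LL_one_sub_pow] at this
  convert this using 4 with k hk
  rw [← Real.exp_nat_mul, zero_mul, add_zero, zero_add, ← Real.exp_add]
  congr 1; ring

lemma AM.continuousAt {g : ℝ → ℝ} {T : ℝ} (h : AM g T) {x : ℝ} (hx : x < T) :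
    ContinuousAt g x := by
  have h0 : ∀ y < T, 0 ≤ g y := fun y hy => by
    simpa using h y hy 1 one_pos 0
  have h1 : ∀ y < T, ∀ z ≤ y, g z ≤ g y := fun y hy z hz => by
    rcases hz.eq_or_lt with rfl | hz
    · rfl
    · have := h y hy (y - z) (by linarith) 1
      simp [Finset.sum_range_succ] at this
      linarith
  have h2 : ∀ y, ∀ H > 0, y + H < T → 2 * g y ≤ g (y - H) + g (y + H) := fun y H hH hy => by
    have := h (y + H) hy H hH 2
    simp [Finset.sum_range_succ] at this
    rw [show y + H - 2 * H = y - H by ring] at this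
    linarith
  obtain ⟨d, hd, hdT⟩ : ∃ d > 0, x + 2 * d < T := ⟨(T - x)/3, by linarith, by linarith⟩
  -- key estimate
  have key : ∀ y < x + d, ∀ k : ℕ, 0 < k → ∀ H > 0, k * H ≤ d → g (y + H) - g y ≤ g (x + 2 * d) / k := by
    intro y hy k hk H hH hkH
    have s1 : ∀ j : ℕ, j < k → g (y + H) - g y ≤ g (y + (j+1 : ℕ) * H) - g (y + j * H) := by
      intro j hj
      induction j with
      | zero => simp
      | succ j ih =>
        have i1 := ih (by omega)
        have : ((j+1+1 : ℕ) : ℝ) ≤ k := by exact_mod_cast hj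
        have i2 := h2 (y + (j+1 : ℕ) * H) H hH (by
          push_cast at *; nlinarith)
        have e1 : y + (j+1 : ℕ) * H - H = y + j * H := by push_cast; ring
        have e2 : y + (j+1 : ℕ) * H + H = y + (j+1+1 : ℕ) * H := by push_cast; ring
        rw [e1, e2] at i2
        linarith
    have s2 : ∀ j : ℕ, j ≤ k → j * (g (y + H) - g y) ≤ g (y + j * H) - g y := by
      intro j hj
      induction j with
      | zero => simp
      | succ j ih =>
        have i1 := ih (by omega)
        have i2 := s1 j (by omega)
        push_cast at *
        linarith
    have s3 := s2 k le_rfl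
    have s4 := h1 (x + 2*d) hdT (y + k * H) (by linarith)
    have s5 := h0 y (by linarith)
    have hk' : (0:ℝ) < k := by exact_mod_cast hk
    rw [le_div_iff₀ hk']
    linarith
  rw [Metric.continuousAt_iff]
  intro ε hε
  obtain ⟨k, hk⟩ := exists_nat_gt (g (x + 2*d) / ε)
  have hg := h0 _ hdT
  have hk0 : (0:ℝ) < k := lt_of_le_of_lt (by positivity) hk
  replace hk : g (x + 2*d) / k < ε := by
    rw [div_lt_iff₀ hε] at hk
    rw [div_lt_iff₀ hk0]; linarith
  have hkn : 0 < k := by exact_mod_cast hk0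
  have hk1 : (1:ℝ) ≤ k := by exact_mod_cast hkn
  refine ⟨d / k, by positivity, fun {y} hy => ?_⟩
  have hdk : d / k ≤ d := div_le_self hd.le hk1
  rw [Real.dist_eq] at hy ⊢
  rcases lt_trichotomy y x with hyx | rfl | hyx
  · rw [abs_sub_comm, abs_of_pos (by linarith)] at hy
    have := key y (by linarith) k hkn (x - y) (by linarith) (by
      rw [lt_div_iff₀ hk0] at hy; linarith)
    rw [show y + (x - y) = x by ring] at this
    have := h1 x hx y hyx.le
    rw [abs_sub_comm, abs_of_nonneg (by linarith)]
    linarith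
  · simpa
  · rw [abs_of_pos (by linarith)] at hy
    have := key x (by linarith) k hkn (y - x) (by linarith) (by
      rw [lt_div_iff₀ hk0] at hy; linarith)
    rw [show x + (y - x) = y by ring] at this
    have := h1 y (by linarith) x hyx.le
    rw [abs_of_nonneg (by linarith)]
    linarith

lemma Fam.continuousAt {f : ℝ → ℝ} {r : ℝ} (h : Fam f r) {x : ℝ} (hx : 0 < x) (hxr : x < r) :
    ContinuousAt f x := by
  have h1 := (h.am_exp (hx.trans hxr)).continuousAt (Real.log_lt_log hx hxr)
  have h2 : ContinuousAt (fun y => f (Real.exp (Real.log y))) x :=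
    ContinuousAt.comp (f := Real.log) h1 (Real.continuousAt_log hx.ne')
  refine h2.congr ?_
  filter_upwards [lt_mem_nhds hx] with y hy
  rw [Real.exp_log hy]

lemma bern (φ : ℝ → ℝ) (hc : ContinuousOn φ (Set.Icc 0 1))
    (hd : ∀ N k : ℕ, 1 ≤ N → k ≤ N → 0 ≤ LL (fun j => φ (j / N)) ((X - 1)^k)) :
    ∃ c : ℕ → ℝ, ∃ M : ℝ, (∀ k, 0 ≤ c k ∧ c k ≤ M) ∧
      ∀ t ∈ Set.Ico (0:ℝ) 1, HasSum (fun k => c k * t^k) (φ t) := by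
  set M := φ 1 with hM
  set a : ℕ → ℕ → ℝ := fun N k =>
    ((N+1).choose k : ℝ) * LL (fun j => φ (j / (N+1 : ℕ))) ((X - 1)^k) with ha
  have a0 : ∀ N k, 0 ≤ a N k := by
    intro N k
    rcases le_or_gt k (N+1) with h | h
    · exact mul_nonneg (by positivity) (hd (N+1) k (by omega) h)
    · simp [ha, Nat.choose_eq_zero_of_lt h]
  have az : ∀ N k, k ∉ Finset.range (N+1+1) → a N k = 0 := by
    intro N k h
    simp only [Finset.mem_range, not_lt] at h
    simp [ha, Nat.choose_eq_zero_of_lt (show N+1 < k by omega)]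
  -- Bernstein polynomials
  have hB : ∀ N, ∀ t : ℝ, ∑ k ∈ Finset.range (N+1+1), a N k * t^k =
      ∑ k ∈ Finset.range (N+1+1), ((N+1).choose k : ℝ) * t^k * (1-t)^(N+1-k) * φ (k / (N+1:ℕ)) := by
    intro N t
    have e : (C t * (X - 1) + 1)^(N+1) = (C t * X + C (1 - t))^(N+1) := by
      congr 1; simp; ring
    rw [add_pow, add_pow] at e
    have e' := congrArg (LL (fun j => φ (j / (N+1 : ℕ)))) e
    rw [map_sum, map_sum] at e'
    convert e' using 1
    · refine Finset.sum_congr rfl fun k _ => ?_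
      have : (C t * (X-1))^k * 1^(N+1-k) * ((N+1).choose k : ℝ[X]) =
        C (((N+1).choose k : ℝ) * t^k) * (X-1)^k := by
        simp [mul_pow]; ring
      rw [this, LL_C_mul]; simp only [ha]; ring
    · refine Finset.sum_congr rfl fun k _ => ?_
      have : (C t * X)^k * (C (1-t))^(N+1-k) * ((N+1).choose k : ℝ[X]) =
        C (((N+1).choose k : ℝ) * t^k * (1-t)^(N+1-k)) * X^k := by
        simp [mul_pow]; ring
      rw [this, LL_C_mul, LL_X_pow]
  have aM : ∀ N k, a N k ≤ M := by
    intro N k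
    have h1 := hB N 1
    rw [Finset.sum_eq_single (s := Finset.range (N+1+1)) (a := N+1)
      (f := fun k => ((N+1).choose k : ℝ) * 1^k * (1-1)^(N+1-k) * φ (k / (N+1:ℕ)))] at h1
    · have hN : ((N+1:ℕ):ℝ) ≠ 0 := by positivity
      simp [-Nat.cast_add, hN, div_self] at h1
      rw [hM, ← h1]
      by_cases hk : k ∈ Finset.range (N+1+1)
      · exact Finset.single_le_sum (f := a N) (fun i _ => a0 N i) hk
      · rw [az N k hk]
        exact Finset.sum_nonneg fun i _ => a0 N i
    · intro b hb hb'
      have : N + 1 - b ≠ 0 := by simp at hb; omega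
      simp [this]
    · simp
  obtain ⟨c, hcm, ψ, hψ, hlim⟩ := (isCompact_univ_pi (fun _ : ℕ => isCompact_Icc (a := (0:ℝ)) (b := M))).tendsto_subseq
    (x := a) (fun N k _ => ⟨a0 N k, aM N k⟩)
  have hck : ∀ k, 0 ≤ c k ∧ c k ≤ M := fun k => hcm k trivial
  refine ⟨c, M, hck, fun t ht => ?_⟩
  have hsum : Summable (fun k : ℕ => M * t^k) :=
    (summable_geometric_of_lt_one ht.1 ht.2).mul_left M
  have hs : Summable (fun k => c k * t^k) :=
    Summable.of_nonneg_of_le (fun k => mul_nonneg (hck k).1 (pow_nonneg ht.1 _))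
      (fun k => mul_le_mul_of_nonneg_right (hck k).2 (pow_nonneg ht.1 _)) hsum
  have l1 : Filter.Tendsto (fun N => ∑' k, a (ψ N) k * t^k) Filter.atTop
      (nhds (∑' k, c k * t^k)) := by
    apply tendsto_tsum_of_dominated_convergence hsum
    · intro k
      exact ((tendsto_pi_nhds.1 hlim) k).mul_const _
    · refine Filter.Eventually.of_forall fun N k => ?_
      rw [Real.norm_of_nonneg (mul_nonneg (a0 _ _) (pow_nonneg ht.1 _))]
      exact mul_le_mul_of_nonneg_right (aM _ _) (pow_nonneg ht.1 _)
  let F : C(unitInterval, ℝ) := ⟨(Set.Icc (0:ℝ) 1).domRestrict φ, hc.domRestrict⟩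
  have l2 : Filter.Tendsto (fun N => ∑' k, a N k * t^k) Filter.atTop (nhds (φ t)) := by
    have u := bernsteinApproximation_uniform F
    have u' := ((ContinuousEvalConst.continuous_eval_const (F := C(unitInterval, ℝ)) (⟨t, ht.1, ht.2.le⟩ : unitInterval)).tendsto F).comp
      (u.comp (Filter.tendsto_add_atTop_nat 1))
    refine u'.congr fun N => ?_
    rw [tsum_eq_sum (s := Finset.range (N+1+1)) (fun k hk => by rw [az N k hk, zero_mul]), hB]
    simp only [Function.comp, bernsteinApproximation.apply, bernstein_apply, Finset.sum_range]
    rfl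
  have := tendsto_nhds_unique l1 (l2.comp hψ.tendsto_atTop)
  rw [← this]
  exact hs.hasSum

lemma hasFPS (c : ℕ → ℝ) (M R : ℝ) (hR : 0 < R) (h : ∀ k, |c k| * R^k ≤ M) :
    HasFPowerSeriesOnBall (fun t => ∑' k, c k * t^k) (FormalMultilinearSeries.ofScalars ℝ c) 0
      (ENNReal.ofReal R) := by
  have hr : ENNReal.ofReal R ≤ (FormalMultilinearSeries.ofScalars ℝ c).radius := by
    have := FormalMultilinearSeries.le_radius_of_bound (FormalMultilinearSeries.ofScalars ℝ c) M
      (r := R.toNNReal) (fun n => by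
        rw [FormalMultilinearSeries.ofScalars_norm, Real.norm_eq_abs, Real.coe_toNNReal _ hR.le]
        exact h n)
    exact this
  have h1 := (FormalMultilinearSeries.ofScalars ℝ c).hasFPowerSeriesOnBall
    (lt_of_lt_of_le (by simpa using hR) hr)
  have h2 := h1.mono (by simpa using hR) hr
  convert h2 using 1
  ext t
  rw [FormalMultilinearSeries.sum]
  refine tsum_congr fun k => ?_
  simp [FormalMultilinearSeries.ofScalars]
  try ring

lemma AM.analyticAt {g : ℝ → ℝ} {T : ℝ} (h : AM g T) {x : ℝ} (hx : x < T) :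
    AnalyticAt ℝ g x := by
  set r := T - x with hr
  have hr0 : 0 < r := by linarith
  set x0 := x - r / 2 with hx0
  have hT : ∀ t ≤ (1:ℝ), x0 + r * t < T := by intro t ht; nlinarith
  obtain ⟨c, M, hcM, hc⟩ := bern (fun t => g (x0 + r * t)) (by
    intro t ht
    have := h.continuousAt (hT t ht.2)
    refine ContinuousAt.continuousWithinAt ?_
    exact ContinuousAt.comp (f := fun t => x0 + r * t) this (by fun_prop)) (by
    intro N k hN hk
    have hN0 : (0:ℝ) < N := by exact_mod_cast hN
    have key := h (x0 + r * (k / N)) (hT _ (by rw [div_le_one hN0]; exact_mod_cast hk)) (r / N)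
      (by positivity) k
    have e : (X - 1 : ℝ[X])^k = ∑ i ∈ Finset.range (k+1), C ((-1)^i * (k.choose i : ℝ)) * X^(k-i) := by
      rw [sub_eq_neg_add, add_pow]
      refine Finset.sum_congr rfl fun i _ => ?_
      simp; ring
    rw [e, map_sum]
    convert key using 1
    refine Finset.sum_congr rfl fun i hi => ?_
    rw [LL_C_mul, LL_X_pow, Nat.cast_sub (by simp at hi; omega)]
    congr 2
    ring)
  have h1 := hasFPS c M 1 one_pos (fun k => by
    rw [one_pow, mul_one, abs_of_nonneg (hcM k).1]; exact (hcM k).2)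
  have h2 : AnalyticAt ℝ (fun t => ∑' k, c k * t^k) ((x - x0) / r) := by
    apply h1.analyticAt_of_mem
    have : (x - x0) / r = 1/2 := by rw [hx0]; field_simp; ring
    rw [this]
    simp [Metric.eball, edist_dist]
    norm_num
  have h3 : AnalyticAt ℝ (fun y => (y - x0) / r) x := by fun_prop
  have h4 := AnalyticAt.fun_comp (f := fun y => (y - x0) / r) h2 h3
  refine h4.congr ?_
  have : Set.Ioo x0 (x0 + r) ∈ nhds x := Ioo_mem_nhds (by linarith) (by linarith)
  filter_upwards [this] with y hy
  have hy' : (y - x0) / r ∈ Set.Ico (0:ℝ) 1 :=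
    ⟨div_nonneg (by linarith [hy.1]) hr0.le, by rw [div_lt_one hr0]; linarith [hy.2]⟩
  rw [(hc _ hy').tsum_eq]
  congr 1
  field_simp
  ring

lemma Fam.am_sign {f : ℝ → ℝ} {r : ℝ} (h : Fam f r) {a : ℝ} (ha : 0 < a) (har : a < r) (σ : ℝ)
    (hσ : σ = 1 ∨ σ = -1) :
    AM (fun x => f (a + Real.exp x) + σ * f (-a + Real.exp x)) (Real.log (r - a)) := by
  intro x hx H hH n
  have hra : 0 < r - a := by linarith
  have hlt : ∀ y < Real.log (r - a), a + Real.exp y < r := by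
    intro y hy
    have : Real.exp y < r - a := by rwa [← Real.lt_log_iff_exp_lt hra]
    linarith
  have hcont : ∀ y < Real.log (r - a), ContinuousAt (fun x => f (a + Real.exp x)) y := by
    intro y hy
    have := h.continuousAt (x := a + Real.exp y) (by positivity) (hlt y hy)
    exact ContinuousAt.comp (f := fun x => a + Real.exp x) this (by fun_prop)
  have hh : Filter.Tendsto (fun m : ℕ => H / (2 * ((m : ℝ) + 1))) Filter.atTop (nhds 0) := by
    have := (tendsto_one_div_add_atTop_nhds_zero_nat (𝕜 := ℝ)).const_mul (H / 2)
    rw [mul_zero] at this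
    refine this.congr fun m => ?_
    field_simp
  have hxh : Filter.Tendsto (fun m : ℕ => x + H / (2 * ((m : ℝ) + 1))) Filter.atTop (nhds x) := by
    simpa using hh.const_add x
  have lim : Filter.Tendsto (fun m : ℕ => ∑ k ∈ Finset.range (n+1), (-1)^k * (n.choose k : ℝ) *
      (f (a + Real.exp (x + H / (2 * ((m:ℝ)+1)) - k * H)) + σ * f (-a + Real.exp (x - k * H))))
      Filter.atTop (nhds (∑ k ∈ Finset.range (n+1), (-1)^k * (n.choose k : ℝ) *
      (f (a + Real.exp (x - k * H)) + σ * f (-a + Real.exp (x - k * H))))) := by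
    apply tendsto_finsetSum
    intro k _
    apply Filter.Tendsto.const_mul
    apply Filter.Tendsto.add_const
    have hk : x - k * H < Real.log (r - a) := by
      have : (0:ℝ) ≤ k * H := by positivity
      linarith
    exact (hcont _ hk).tendsto.comp (hxh.sub_const _)
  refine ge_of_tendsto lim ?_
  filter_upwards [hxh.eventually (gt_mem_nhds hx)] with m hm
  set d := H / (2 * ((m:ℝ)+1)) with hd
  have hd0 : 0 < d := by positivity
  have hHd : H = 2 * ((m:ℝ)+1) * d := by rw [hd]; field_simp
  have key := (h.posB (a := 0) (b := Real.exp (x + d)) (c := a) (u := Real.exp (-d)) le_rfl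
    (Real.exp_pos _).le ha.le (Real.exp_pos _) (by simpa using hd0.le)
    (by have := hlt _ hm; linarith)).final_nonneg (m+1) n
  set s : ℕ → ℝ := fun k => f (0 + Real.exp (x + d) * Real.exp (-d)^k + a * (-1)^k) with hs
  have s0 : ∀ k : ℕ, s (2*(m+1)*k+0) = f (a + Real.exp (x + d - k * H)) := by
    intro k
    have e : Even (2*(m+1)*k+0) := ⟨(m+1)*k, by ring⟩
    simp only [hs]
    rw [e.neg_one_pow, ← Real.exp_nat_mul, ← Real.exp_add, zero_add, mul_one, add_comm a, hHd]
    congr 3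
    push_cast; ring
  have s1 : ∀ k : ℕ, s (2*(m+1)*k+1) = f (-a + Real.exp (x - k * H)) := by
    intro k
    have e : Odd (2*(m+1)*k+1) := ⟨(m+1)*k, by ring⟩
    simp only [hs]
    rw [e.neg_one_pow, ← Real.exp_nat_mul, ← Real.exp_add, zero_add, add_comm (-a), hHd]
    congr 2
    · congr 1
      push_cast; ring
    · ring
  have e0 := LL_one_sub_pow_pow s (m+1) n 0
  have e1 := LL_one_sub_pow_pow s (m+1) n 1
  simp only [s0] at e0
  simp only [s1] at e1
  rw [pow_zero, mul_one] at e0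
  rw [pow_one] at e1
  rw [mul_add, mul_sub, mul_one, map_add, map_sub, e0, e1] at key
  rcases hσ with rfl | rfl
  · refine key.1.trans_eq ?_
    rw [← Finset.sum_add_distrib]
    refine Finset.sum_congr rfl fun k _ => ?_
    ring
  · refine key.2.trans_eq ?_
    rw [← Finset.sum_sub_distrib]
    refine Finset.sum_congr rfl fun k _ => ?_
    ring

lemma Fam.analyticAt {f : ℝ → ℝ} {r : ℝ} (h : Fam f r) {z : ℝ} (hz : |z| < r) :
    AnalyticAt ℝ f z := by
  obtain ⟨hz1, hz2⟩ := abs_lt.1 hz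
  obtain ⟨a, ha1, ha2⟩ : ∃ a, max 0 (-z) < a ∧ a < (r - z) / 2 := by
    apply exists_between
    rw [max_lt_iff]; constructor <;> linarith
  rw [max_lt_iff] at ha1
  have har : a < r := by linarith
  have hT : Real.log (z + a) < Real.log (r - a) := Real.log_lt_log (by linarith) (by linarith)
  have h1 := (h.am_sign ha1.1 har 1 (Or.inl rfl)).analyticAt hT
  have h2 := (h.am_sign ha1.1 har (-1) (Or.inr rfl)).analyticAt hT
  have h3 := ((h1.sub h2).fun_mul (analyticAt_const (v := (1/2 : ℝ))))
  have h4 : AnalyticAt ℝ (fun w => Real.log (w + a)) z := by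
    have := analyticAt_log (x := z + a) (by linarith)
    exact AnalyticAt.fun_comp (f := fun w => w + a) this (by fun_prop)
  have h5 := AnalyticAt.fun_comp (f := fun w => Real.log (w + a)) h3 h4
  refine h5.congr ?_
  filter_upwards [lt_mem_nhds (show -a < z by linarith)] with w hw
  simp only [Pi.sub_apply]
  rw [Real.exp_log (by linarith)]
  rw [show -a + (w + a) = w by ring]
  ring

lemma Fam.deriv_nonneg {f : ℝ → ℝ} {r : ℝ} (h : Fam f r) {a : ℝ} (ha : 0 ≤ a) (har : a < r)
    (n : ℕ) : 0 ≤ iteratedDeriv n f a := by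
  have hf := h.analyticAt (z := a) (by rwa [abs_of_nonneg ha])
  have hp := hf.hasFPowerSeriesAt
  set d : ℕ → ℝ := fun n => iteratedDeriv n f a / n.factorial with hd
  have hO := hp.isBigO_sub_partialSum_pow (n+1)
  set R : ℝ → ℝ := fun y => f (a + y) - ∑ m ∈ Finset.range (n+1), d m * y^m with hR
  have hRO : R =O[nhds 0] fun y : ℝ => y^(n+1) := by
    refine Asymptotics.IsBigO.of_norm_right ?_
    simp only [norm_pow]
    refine hO.congr_left fun y => ?_
    simp only [hR, FormalMultilinearSeries.partialSum]
    congr 1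
    refine Finset.sum_congr rfl fun m _ => ?_
    rw [FormalMultilinearSeries.ofScalars_apply_eq, smul_eq_mul]
  set u : ℝ := 1/2 with hu
  set q : ℝ[X] := ∏ m ∈ Finset.range n, (X - C (u^m)) with hq
  set P := q * q with hP
  set N := P.natDegree + 1 with hN
  have hev : ∀ m < n, P.eval (u^m) = 0 := by
    intro m hm
    rw [hP, eval_mul, hq, eval_prod, Finset.prod_eq_zero (Finset.mem_range.2 hm) (by simp), zero_mul]
  have hpos : 0 < P.eval (u^n) := by
    rw [hP, eval_mul]
    apply mul_self_pos.2
    rw [hq, eval_prod, Finset.prod_ne_zero_iff]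
    intro m hm
    simp only [eval_sub, eval_X, eval_C]
    rw [sub_ne_zero]
    have : u^n < u^m := pow_lt_pow_right_of_lt_one₀ (by norm_num [hu]) (by norm_num [hu])
      (Finset.mem_range.1 hm)
    exact this.ne
  have hLL : ∀ b : ℝ, LL (fun k => f (a + b * u^k + 0 * (-1)^k)) P - d n * P.eval (u^n) * b^n =
      ∑ k ∈ Finset.range N, P.coeff k * R (b * u^k) := by
    intro b
    rw [LL_range _ P N (by omega)]
    have : ∑ k ∈ Finset.range N, P.coeff k * ∑ m ∈ Finset.range (n+1), d m * (b * u^k)^m =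
        d n * P.eval (u^n) * b^n := by
      simp only [Finset.mul_sum]
      rw [Finset.sum_comm, Finset.sum_eq_single n]
      · rw [eval_eq_sum_range, Finset.mul_sum, Finset.sum_mul]
        refine Finset.sum_congr rfl fun k _ => ?_
        rw [mul_pow, ← pow_mul, ← pow_mul, mul_comm k n]; ring
      · intro m hm hmn
        have hm' : m < n := by simp at hm; omega
        have := hev m hm'
        rw [eval_eq_sum_range] at this
        calc _ = d m * b^m * ∑ k ∈ Finset.range N, P.coeff k * (u^m)^k := by
              rw [Finset.mul_sum]
              refine Finset.sum_congr rfl fun k _ => ?_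
              rw [mul_pow, ← pow_mul, ← pow_mul, mul_comm k m]; ring
          _ = 0 := by rw [this, mul_zero]
      · simp
    rw [← this, ← Finset.sum_sub_distrib]
    refine Finset.sum_congr rfl fun k _ => ?_
    simp only [hR, zero_mul, add_zero]
    ring
  have hbig : (fun b : ℝ => ∑ k ∈ Finset.range N, P.coeff k * R (b * u^k)) =O[nhds 0]
      fun b : ℝ => b^(n+1) := by
    apply Asymptotics.IsBigO.fun_sum
    intro k _
    apply Asymptotics.IsBigO.const_mul_left
    have t : Filter.Tendsto (fun b : ℝ => b * u^k) (nhds 0) (nhds 0) := by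
      have : Continuous (fun b : ℝ => b * u^k) := by fun_prop
      simpa using this.tendsto 0
    refine (hRO.comp_tendsto t).trans ?_
    simp only [Function.comp_def, mul_pow]
    refine Asymptotics.IsBigO.of_bound (|(u^k)^(n+1)|) (Filter.Eventually.of_forall fun b => ?_)
    rw [norm_mul, Real.norm_eq_abs, Real.norm_eq_abs, mul_comm]
  have hsmall : (fun b : ℝ => ∑ k ∈ Finset.range N, P.coeff k * R (b * u^k)) =o[nhds 0]
      fun b : ℝ => b^n := hbig.trans_isLittleO (Asymptotics.isLittleO_pow_pow (by omega))
  have ht := hsmall.tendsto_div_nhds_zero.mono_left (nhdsWithin_le_nhds (s := Set.Ioi 0))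
  have hfin : -(d n * P.eval (u^n)) ≤ 0 := by
    refine ge_of_tendsto ht ?_
    filter_upwards [Ioo_mem_nhdsGT (show (0:ℝ) < r - a by linarith)] with b hb
    have k1 := h a b 0 u ha hb.1.le le_rfl (by norm_num [hu]) (by norm_num [hu])
      (by linarith [hb.2]) q
    have k2 := hLL b
    have hbn : 0 < b^n := pow_pos hb.1 n
    rw [le_div_iff₀ hbn, ← k2]
    linarith
  have hdn : 0 ≤ d n := by
    by_contra hneg
    push Not at hneg
    nlinarith
  have : iteratedDeriv n f a = d n * n.factorial := by
    simp only [hd]; field_simp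
  rw [this]; positivity

lemma Fam.taylor_le {f : ℝ → ℝ} {r : ℝ} (h : Fam f r) {x : ℝ} (hx : 0 < x) (hxr : x < r)
    (n : ℕ) : iteratedDeriv n f 0 / n.factorial * x^n ≤ f x := by
  have hA : ∀ y ∈ Set.Icc 0 x, ContDiffAt ℝ (n+1) f y := fun y hy =>
    (h.analyticAt (z := y) (by rw [abs_of_nonneg hy.1]; linarith [hy.2])).contDiffAt
  have hu : Set.uIcc 0 x = Set.Icc 0 x := Set.uIcc_of_le hx.le
  obtain ⟨y, hy, he⟩ := taylor_mean_remainder_lagrange_iteratedDeriv (f := f) (n := n) hx.ne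
    (by rw [hu]; exact fun y hy => (hA y hy).contDiffWithinAt)
  rw [Set.uIoo_of_le hx.le] at hy
  rw [hu, taylor_within_apply] at he
  have hpos : 0 ≤ iteratedDeriv (n + 1) f y * (x - 0) ^ (n + 1) / (n + 1).factorial := by
    have := h.deriv_nonneg hy.1.le (by linarith [hy.2]) (n+1)
    have : 0 ≤ x - 0 := by linarith
    positivity
  have hz : (0:ℝ) ∈ Set.Icc 0 x := ⟨le_rfl, hx.le⟩
  have ht : ∀ k ≤ n, iteratedDerivWithin k f (Set.Icc 0 x) 0 = iteratedDeriv k f 0 := fun k hk =>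
    iteratedDerivWithin_eq_iteratedDeriv (uniqueDiffOn_Icc hx)
      ((hA 0 hz).of_le (by exact_mod_cast (by omega : k ≤ n + 1))) hz
  have hle := Finset.single_le_sum (s := Finset.range (n+1)) (a := n)
    (f := fun k => ((k.factorial : ℝ)⁻¹ * (x - 0) ^ k) • iteratedDerivWithin k f (Set.Icc 0 x) 0)
    (fun k hk => by
      rw [ht k (by simp at hk; omega), sub_zero, smul_eq_mul]
      have := h.deriv_nonneg le_rfl (hx.trans hxr) k
      positivity) (by simp)
  rw [ht n le_rfl, sub_zero, smul_eq_mul] at hle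
  rw [← he] at hpos
  simp only [sub_zero] at hpos hle
  have e : iteratedDeriv n f 0 / n.factorial * x^n = (n.factorial:ℝ)⁻¹ * x^n * iteratedDeriv n f 0 := by
    field_simp
  rw [e]
  linarith

lemma Fam.hasSum {f : ℝ → ℝ} {r : ℝ} (h : Fam f r) {x : ℝ} (hx : |x| < r) :
    HasSum (fun k => iteratedDeriv k f 0 / k.factorial * x^k) (f x) := by
  obtain ⟨R, hR1, hR2⟩ := exists_between hx
  have hR0 : 0 < R := (abs_nonneg x).trans_lt hR1
  set c : ℕ → ℝ := fun k => iteratedDeriv k f 0 / k.factorial with hc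
  have hc0 : ∀ k, 0 ≤ c k := fun k => div_nonneg (h.deriv_nonneg le_rfl (hR0.trans hR2) k) (by positivity)
  have h1 := hasFPS c (f R) R hR0 (fun k => by
    rw [abs_of_nonneg (hc0 k)]; exact h.taylor_le hR0 hR2 k)
  have h2 := (h.analyticAt (z := 0) (by simpa using hR0.trans hR2)).hasFPowerSeriesAt
  have hee : f =ᶠ[nhds 0] fun t => ∑' k, c k * t^k := by
    have a1 := h2.eventually_hasSum
    have a2 := h1.hasFPowerSeriesAt.eventually_hasSum
    filter_upwards [a1, a2] with y b1 b2
    have := b1.unique b2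
    simpa using this
  have hball : ∀ y ∈ Metric.ball (0:ℝ) R, y ∈ Metric.eball (0:ℝ) (ENNReal.ofReal R) := by
    intro y hy
    rwa [Metric.eball_ofReal]
  have hEq := AnalyticOnNhd.eqOn_of_preconnected_of_eventuallyEq (U := Metric.ball (0:ℝ) R)
    (f := f) (g := fun t => ∑' k, c k * t^k) (z₀ := 0)
    (fun y hy => h.analyticAt (by simp at hy; linarith))
    (fun y hy => h1.analyticAt_of_mem (hball y hy))
    (convex_ball (0:ℝ) R).isPreconnected (by simpa using hR0) hee
  have hxb : x ∈ Metric.ball (0:ℝ) R := by simpa using hR1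
  have hs := h1.hasSum (hball x hxb)
  have hfx : f x = ∑' k, c k * x^k := hEq hxb
  rw [zero_add] at hs
  have he : (fun k => iteratedDeriv k f 0 / k.factorial * x^k) =
      fun k => (FormalMultilinearSeries.ofScalars ℝ c k) fun _ => x := by
    ext k
    rw [FormalMultilinearSeries.ofScalars_apply_eq, smul_eq_mul]
  rw [he, hfx]
  exact hs

lemma pow_map_psd {n : ℕ} {A : Matrix (Fin n) (Fin n) ℝ} (hA : A.PosSemidef) (k : ℕ) :
    (A.map (fun x => x^k)).PosSemidef := by
  induction k with
  | zero =>
    have := Matrix.posSemidef_vecMulVec_self_star (fun _ : Fin n => (1:ℝ))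
    convert this using 1
    ext i j
    simp [Matrix.vecMulVec_apply]
  | succ k ih =>
    have e : A.map (fun x => x^(k+1)) = (A.map fun x => x^k).hadamard A := by
      ext i j
      simp [Matrix.hadamard, pow_succ]
    rw [e]
    exact ih.hadamard hA

lemma series_psd {n : ℕ} {A : Matrix (Fin n) (Fin n) ℝ} (hA : A.PosSemidef) (f : ℝ → ℝ)
    (c : ℕ → ℝ) (hc : ∀ k, 0 ≤ c k) (h : ∀ i j, HasSum (fun k => c k * (A i j)^k) (f (A i j))) :
    (A.map f).PosSemidef := by
  refine Matrix.PosSemidef.of_dotProduct_mulVec_nonneg ?_ fun x => ?_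
  · ext i j
    have := hA.1.apply i j
    simp only [star_trivial] at this
    simp [this]
  · have hs : HasSum (fun k => ∑ i, x i * ∑ j, c k * (A i j)^k * x j)
        (∑ i, x i * ∑ j, f (A i j) * x j) :=
      hasSum_sum fun i _ => (hasSum_sum fun j _ => (h i j).mul_right (x j)).mul_left (x i)
    refine hs.nonneg fun k => ?_
    have := ((pow_map_psd hA k).smul (hc k)).dotProduct_mulVec_nonneg x
    exact this

end helpers

/-- Belton–Guillot–Khare–Putinar's strengthening of Schoenberg's theorem: for
`f : (−ρ, ρ) → ℝ` (with `0 < ρ ≤ ∞`), preserving positive semidefiniteness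
entrywise on all `P_n((−ρ,ρ))`, on all Hankel matrices of rank at most 3 in
`P_n((−ρ,ρ))`, and being a power series with non-negative coefficients on
`(−ρ,ρ)`, are all equivalent. -/
theorem stmt10 (ρ : ℝ≥0∞) (hρ : 0 < ρ) (f : ℝ → ℝ) :
    ((∀ n : ℕ, 1 ≤ n → ∀ A : Matrix (Fin n) (Fin n) ℝ, A.PosSemidef →
        (∀ j k, ENNReal.ofReal |A j k| < ρ) → (A.map f).PosSemidef) ↔
      (∀ n : ℕ, 1 ≤ n → ∀ A : Matrix (Fin n) (Fin n) ℝ, A.PosSemidef →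
        (∀ j k, ENNReal.ofReal |A j k| < ρ) →
        (∀ j k l m : Fin n, (j : ℕ) + (k : ℕ) = (l : ℕ) + (m : ℕ) →
          A j k = A l m) →
        A.rank ≤ 3 → (A.map f).PosSemidef)) ∧
    ((∀ n : ℕ, 1 ≤ n → ∀ A : Matrix (Fin n) (Fin n) ℝ, A.PosSemidef →
        (∀ j k, ENNReal.ofReal |A j k| < ρ) →
        (∀ j k l m : Fin n, (j : ℕ) + (k : ℕ) = (l : ℕ) + (m : ℕ) →
          A j k = A l m) →
        A.rank ≤ 3 → (A.map f).PosSemidef) ↔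
      (∃ c : ℕ → ℝ, (∀ k, 0 ≤ c k) ∧
        ∀ x : ℝ, ENNReal.ofReal |x| < ρ →
          HasSum (fun k => c k * x ^ k) (f x))) := by
  have h31 : (∃ c : ℕ → ℝ, (∀ k, 0 ≤ c k) ∧
        ∀ x : ℝ, ENNReal.ofReal |x| < ρ →
          HasSum (fun k => c k * x ^ k) (f x)) →
      (∀ n : ℕ, 1 ≤ n → ∀ A : Matrix (Fin n) (Fin n) ℝ, A.PosSemidef →
        (∀ j k, ENNReal.ofReal |A j k| < ρ) → (A.map f).PosSemidef) := by
    rintro ⟨c, hc, h⟩ n _ A hA hAρ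
    exact series_psd hA f c hc fun i j => h _ (hAρ i j)
  have h23 : (∀ n : ℕ, 1 ≤ n → ∀ A : Matrix (Fin n) (Fin n) ℝ, A.PosSemidef →
        (∀ j k, ENNReal.ofReal |A j k| < ρ) →
        (∀ j k l m : Fin n, (j : ℕ) + (k : ℕ) = (l : ℕ) + (m : ℕ) →
          A j k = A l m) →
        A.rank ≤ 3 → (A.map f).PosSemidef) →
      (∃ c : ℕ → ℝ, (∀ k, 0 ≤ c k) ∧
        ∀ x : ℝ, ENNReal.ofReal |x| < ρ →
          HasSum (fun k => c k * x ^ k) (f x)) := by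
    intro h
    have hr : ∀ x : ℝ, ENNReal.ofReal |x| < ρ → ∃ r, |x| < r ∧ ENNReal.ofReal r ≤ ρ := by
      intro x hx
      obtain ⟨q, hq1, hq2⟩ := exists_between hx
      refine ⟨q.toReal, (ENNReal.ofReal_lt_iff_lt_toReal (abs_nonneg _) hq2.ne_top).1 hq1, ?_⟩
      rw [ENNReal.ofReal_toReal hq2.ne_top]
      exact hq2.le
    refine ⟨fun k => iteratedDeriv k f 0 / k.factorial, fun k => ?_, fun x hx => ?_⟩
    · obtain ⟨r, hr0, hrρ⟩ := hr 0 (by simpa using hρ)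
      rw [abs_zero] at hr0
      exact div_nonneg ((fam_of_matrix ρ f h r hrρ).deriv_nonneg le_rfl hr0 k) (by positivity)
    · obtain ⟨r, hr0, hrρ⟩ := hr x hx
      exact (fam_of_matrix ρ f h r hrρ).hasSum hr0
  exact ⟨⟨fun h n hn A hA hAρ _ _ => h n hn A hA hAρ, fun h => h31 (h23 h)⟩,
    ⟨h23, fun h n hn A hA hAρ _ _ => h31 h n hn A hA hAρ⟩⟩
end

section
/- (Jain) Let N ≥ 2 and let u = (u₁, …, u_N)ᵀ ∈ (0, ∞)^N have pairwise distinct entries. Set A := [1 + u_j u_k]_{j,k=1}^N. Then for α ∈ ℝ, the entrywise power A^{∘α} = [(1 + u_j u_k)^α] is positive semidefinite if and only if α is a non-negative integer or α ≥ N − 2. -/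
open Matrix Filter Topology

theorem jain_zeros (n : ℕ) : ∀ (u : Fin n → ℝ) (_ : ∀ j, 0 < u j) (_ : Function.Injective u)
    (c : Fin n → ℝ) (α : ℝ) (_ : ∀ i : ℕ, i + 2 ≤ n → α ≠ i)
    (x : Fin n → ℝ) (_ : ∀ k, 0 < x k) (_ : StrictMono x)
    (_ : ∀ k, ∑ j, c j * (1 + u j * x k) ^ α = 0), c = 0 := by
  induction n with
  | zero => intros; ext j; exact j.elim0
  | succ n ih =>
    intro u hu hinj c α hα x hx hmono h
    have hpos : ∀ j y, 0 < y → 0 < 1 + u j * y := fun j y hy => by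
      have := mul_pos (hu j) hy; linarith
    set f : ℝ → ℝ := fun y => ∑ j, c j * ((1 + u j * y) / (1 + u 0 * y)) ^ α with hf
    set f' : ℝ → ℝ := fun y => ∑ j, c j * ((u j - u 0) / (1 + u 0 * y) ^ 2 * α *
      ((1 + u j * y) / (1 + u 0 * y)) ^ (α - 1)) with hf'
    have hder : ∀ y, 0 < y → HasDerivAt f (f' y) y := by
      intro y hy
      refine HasDerivAt.fun_sum fun j _ => ?_
      refine HasDerivAt.const_mul _ ?_
      refine HasDerivAt.rpow_const ?_ (Or.inl (div_pos (hpos j y hy) (hpos 0 y hy)).ne')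
      have h1 : ∀ j, HasDerivAt (fun y => 1 + u j * y) (u j) y := fun j => by
        simpa using ((hasDerivAt_id y).const_mul (u j)).const_add 1
      have : u j - u 0 = u j * (1 + u 0 * y) - (1 + u j * y) * u 0 := by ring
      rw [this]
      exact (h1 j).fun_div (h1 0) (hpos 0 y hy).ne'
    have hfx : ∀ k, f (x k) = 0 := by
      intro k
      have : f (x k) = (∑ j, c j * (1 + u j * x k) ^ α) / (1 + u 0 * x k) ^ α := by
        rw [Finset.sum_div]
        refine Finset.sum_congr rfl fun j _ => ?_
        rw [Real.div_rpow (hpos j _ (hx k)).le (hpos 0 _ (hx k)).le, mul_div_assoc]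
      rw [this, h k, zero_div]
    have hR : ∀ k : Fin n, ∃ y ∈ Set.Ioo (x k.castSucc) (x k.succ), f' y = 0 := by
      intro k
      refine exists_hasDerivAt_eq_zero (f := f) (hmono Fin.castSucc_lt_succ) ?_ ?_ ?_
      · intro y hy
        exact (hder y ((hx _).trans_le hy.1)).continuousAt.continuousWithinAt
      · rw [hfx, hfx]
      · intro y hy
        exact hder y ((hx _).trans hy.1)
    choose y hy hy0 using hR
    have hypos : ∀ k, 0 < y k := fun k => (hx _).trans (hy k).1
    have hc : (fun j : Fin n => c j.succ * α * (u j.succ - u 0)) = 0 := by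
      refine ih (fun j => u j.succ) (fun j => hu _) (hinj.comp (Fin.succ_injective n)) _ (α - 1)
        ?_ y hypos ?_ ?_
      · intro i hi h1
        refine hα (i + 1) (by omega) ?_
        push_cast; linarith
      · intro a b hab
        have h1 : x a.succ ≤ x b.castSucc := hmono.monotone (by
          rw [Fin.le_def]; simp; exact hab)
        exact ((hy a).2.trans_le h1).trans (hy b).1
      · intro k
        have h0 := hpos 0 _ (hypos k)
        have : f' (y k) * ((1 + u 0 * y k) ^ 2 * (1 + u 0 * y k) ^ (α - 1)) =
            ∑ j : Fin n, c j.succ * α * (u j.succ - u 0) * (1 + u j.succ * y k) ^ (α - 1) := by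
          rw [hf']
          simp only
          rw [Fin.sum_univ_succ, sub_self, zero_div, zero_mul, zero_mul, mul_zero, zero_add,
            Finset.sum_mul]
          refine Finset.sum_congr rfl fun j _ => ?_
          rw [Real.div_rpow (hpos _ _ (hypos k)).le h0.le]
          have h2 := (Real.rpow_pos_of_pos h0 (α - 1)).ne'
          field_simp
        rw [← this, hy0 k, zero_mul]
    have hcs : ∀ j : Fin n, c j.succ = 0 := by
      intro j
      have h1 := congrFun hc j
      simp only [Pi.zero_apply, mul_eq_zero] at h1
      have hα0 : α ≠ 0 := by
        have := hα 0 (by have := j.2; omega)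
        simpa using this
      have hu0 : u j.succ - u 0 ≠ 0 := sub_ne_zero.2 fun h => Fin.succ_ne_zero j (hinj h)
      tauto
    have h0 := h 0
    rw [Fin.sum_univ_succ] at h0
    simp only [hcs, zero_mul, Finset.sum_const_zero, add_zero] at h0
    have hc0 : c 0 = 0 := by
      rcases mul_eq_zero.1 h0 with h1 | h1
      · exact h1
      · exact absurd h1 (Real.rpow_pos_of_pos (hpos 0 _ (hx 0)) α).ne'
    ext j
    refine Fin.cases hc0 hcs j

theorem jain_nonsing (n : ℕ) (u : Fin n → ℝ) (hu : ∀ j, 0 < u j) (hinj : Function.Injective u)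
    (c : Fin n → ℝ) (α : ℝ) (hα : ∀ i : ℕ, i + 2 ≤ n → α ≠ i) (s : ℝ) (hs : 0 < s)
    (h : ∀ k, ∑ j, (1 + s * (u k * u j)) ^ α * c j = 0) : c = 0 := by
  refine jain_zeros n u hu hinj c α hα (fun k => s * u (Tuple.sort u k)) (fun k => mul_pos hs (hu _)) ?_ ?_
  · have h1 : StrictMono (u ∘ Tuple.sort u) :=
      (Tuple.monotone_sort u).strictMono_of_injective (hinj.comp (Tuple.sort u).injective)
    intro a b hab
    exact mul_lt_mul_of_pos_left (h1 hab) hs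
  · intro k
    rw [← h (Tuple.sort u k)]
    refine Finset.sum_congr rfl fun j _ => ?_
    rw [mul_comm]; congr 2; ring

theorem jain_clopen {T : Type*} [TopologicalSpace T] [PreconnectedSpace T] (n : ℕ)
    (M : T → Matrix (Fin n) (Fin n) ℝ) (hM : Continuous M) (hsym : ∀ t, (M t).IsHermitian)
    (hns : ∀ t c, M t *ᵥ c = 0 → c = 0) (t₀ : T) (h0 : (M t₀).PosSemidef) (t : T) :
    (M t).PosSemidef := by
  set Q : T → (Fin n → ℝ) → ℝ := fun t c => c ⬝ᵥ (M t *ᵥ c) with hQ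
  have hQc : Continuous fun p : T × (Fin n → ℝ) => Q p.1 p.2 := by
    simp only [hQ]
    exact continuous_snd.dotProduct ((hM.comp continuous_fst).matrix_mulVec continuous_snd)
  have hpsd : ∀ t, (M t).PosSemidef ↔ ∀ c, 0 ≤ Q t c := by
    intro t
    rw [posSemidef_iff_dotProduct_mulVec]
    exact ⟨fun h c => by simpa [hQ] using h.2 c, fun h => ⟨hsym t, fun c => by simpa [hQ] using h c⟩⟩
  have hpd : ∀ t, (M t).PosSemidef ↔ ∀ c ∈ Metric.sphere (0 : Fin n → ℝ) 1, 0 < Q t c := by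
    intro t
    constructor
    · intro h c hc
      refine lt_of_le_of_ne ((hpsd t).1 h c) fun h1 => ?_
      have h2 := (h.dotProduct_mulVec_zero_iff c).1 (by simpa [hQ] using h1.symm)
      have h3 := hns t c h2
      rw [h3] at hc
      simp at hc
    · intro h
      rw [hpsd]
      intro c
      by_cases hc : c = 0
      · simp [hc, hQ]
      · have hn : 0 < ‖c‖ := norm_pos_iff.2 hc
        have h1 := h (‖c‖⁻¹ • c) (by simp [norm_smul, hn.ne'])
        have h2 : Q t (‖c‖⁻¹ • c) = ‖c‖⁻¹ * (‖c‖⁻¹ * Q t c) := by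
          simp [hQ, mulVec_smul]
        rw [h2] at h1
        have h3 : 0 < ‖c‖⁻¹ := inv_pos.2 hn
        exact (pos_of_mul_pos_right (pos_of_mul_pos_right h1 h3.le) h3.le).le
  have hcl : IsClopen {t | (M t).PosSemidef} := by
    constructor
    · simp only [hpsd, Set.ofPred_forall]
      refine isClosed_iInter fun c => ?_
      exact isClosed_le continuous_const (hQc.comp (Continuous.prodMk_left c))
    · rw [isOpen_iff_mem_nhds]
      intro t ht
      have h1 := (hpd t).1 ht
      have := (isCompact_sphere (0 : Fin n → ℝ) 1).eventually_forall_of_forall_eventually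
        (x₀ := t) (P := fun t c => 0 < Q t c) (fun c hc =>
          (hQc.continuousAt (x := (t, c))).eventually (lt_mem_nhds (h1 c hc)))
      filter_upwards [this] with t' ht'
      exact (hpd t').2 ht'
  have := hcl.eq_univ ⟨t₀, h0⟩
  exact Set.eq_univ_iff_forall.1 this t

theorem jain_nat (n : ℕ) (u : Fin n → ℝ) (m : ℕ) :
    (Matrix.of fun j k : Fin n => (1 + u j * u k) ^ (m : ℝ)).PosSemidef := by
  have : (Matrix.of fun j k : Fin n => (1 + u j * u k) ^ (m : ℝ)) =
      ∑ i ∈ Finset.range (m + 1), (m.choose i : ℝ) • vecMulVec (fun j => u j ^ i) (star fun j => u j ^ i) := by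
    ext j k
    simp only [Matrix.of_apply, Real.rpow_natCast, Matrix.sum_apply, Matrix.smul_apply, vecMulVec_apply]
    rw [add_comm, add_pow]
    refine Finset.sum_congr rfl fun i _ => ?_
    simp [mul_pow]; ring
  rw [this]
  refine posSemidef_sum _ fun i _ => ?_
  exact (posSemidef_vecMulVec_self_star _).smul (by positivity)

theorem jain_choose (α : ℝ) (K : ℕ) :
    (K.factorial : ℝ) * Ring.choose α K = ∏ i ∈ Finset.range K, (α - i) := by
  rw [Ring.choose_eq_smul, smul_eq_mul, mul_inv_cancel_left₀ (by exact_mod_cast K.factorial_ne_zero)]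
  induction K with
  | zero => simp
  | succ K ih =>
    rw [descPochhammer_succ_right, Polynomial.smeval_mul, ih, Finset.prod_range_succ]
    simp [Polynomial.smeval_sub, Polynomial.smeval_natCast]

theorem jain_neg (α : ℝ) (N : ℕ) (hN : 2 ≤ N) (hα : ∀ m : ℕ, α ≠ m) (h : α < N - 2) :
    ∃ K < N, Ring.choose α K < 0 := by
  rcases lt_or_ge α 0 with h0 | h0
  · exact ⟨1, by omega, by simpa using h0⟩
  · set m := ⌊α⌋₊ with hm
    have h1 : (m : ℝ) < α := lt_of_le_of_ne (Nat.floor_le h0) (hα m).symm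
    have h2 : α < m + 1 := Nat.lt_floor_add_one α
    refine ⟨m + 2, ?_, ?_⟩
    · have : (m : ℝ) + 2 < N := by linarith
      exact_mod_cast this
    · have h3 := jain_choose α (m + 2)
      rw [Finset.prod_range_succ] at h3
      have h4 : 0 < ∏ i ∈ Finset.range (m + 1), (α - i) := by
        refine Finset.prod_pos fun i hi => ?_
        have : (i : ℝ) ≤ m := by exact_mod_cast Finset.mem_range_succ_iff.1 hi
        linarith
      have h5 : α - ((m + 1 : ℕ) : ℝ) < 0 := by push_cast; linarith
      have h6 := mul_neg_of_pos_of_neg h4 h5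
      rw [← h3] at h6
      exact (pos_iff_neg_of_mul_neg h6).1 (by positivity)

theorem jain_taylor (α : ℝ) (K : ℕ) (a : ℝ) :
    (fun s : ℝ => (1 + s * a) ^ α - ∑ i ∈ Finset.range (K + 1), Ring.choose α i * (s * a) ^ i)
      =o[𝓝[>] 0] fun s => s ^ K := by
  have h := (Real.one_add_rpow_hasFPowerSeriesAt_zero (a := α)).isBigO_sub_partialSum_pow (K + 1)
  have ht : Tendsto (fun s : ℝ => s * a) (𝓝[>] 0) (𝓝 0) := by
    have : Continuous fun s : ℝ => s * a := by fun_prop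
    simpa using (this.tendsto 0).mono_left nhdsWithin_le_nhds
  have h1 := h.comp_tendsto ht
  have h2 : (fun s : ℝ => s ^ (K + 1)) =o[𝓝[>] 0] fun s => s ^ K :=
    (Asymptotics.isLittleO_pow_pow (Nat.lt_succ_self K)).mono nhdsWithin_le_nhds
  have h3 : ((fun y : ℝ => ‖y‖ ^ (K + 1)) ∘ fun s : ℝ => s * a) =O[𝓝[>] 0]
      fun s : ℝ => s ^ (K + 1) := by
    refine Asymptotics.IsBigO.of_bound (|a| ^ (K + 1)) (Eventually.of_forall fun s => ?_)
    simp [mul_pow, mul_comm]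
  refine ((h1.trans h3).trans_isLittleO h2).congr_left fun s => ?_
  have hco : ∀ i, (binomialSeries ℝ α).coeff i = Ring.choose α i := fun i => by
    rw [FormalMultilinearSeries.coeff, binomialSeries_apply, List.prod_ofFn]
    simp
  simp [FormalMultilinearSeries.partialSum, hco, mul_comm]

theorem jain_limit (n : ℕ) (u : Fin n → ℝ) (hinj : Function.Injective u) (α : ℝ) (K : ℕ) (hK : K < n)
    (h : ∀ s : ℝ, 0 < s → (Matrix.of fun j k : Fin n => (1 + s * (u j * u k)) ^ α).PosSemidef) :
    0 ≤ Ring.choose α K := by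
  obtain ⟨c, hc⟩ : ∃ c : Fin n → ℝ, c ᵥ* vandermonde u = Pi.single ⟨K, hK⟩ 1 := by
    refine ⟨Pi.single ⟨K, hK⟩ 1 ᵥ* (vandermonde u)⁻¹, ?_⟩
    rw [vecMul_vecMul, nonsing_inv_mul _ (det_vandermonde_ne_zero_iff.2 hinj).isUnit, vecMul_one]
  have hc' : ∀ i, i < K + 1 → ∑ j, c j * u j ^ i = if i = K then 1 else 0 := by
    intro i hi
    have := congrFun hc ⟨i, by omega⟩
    simpa [vecMul, dotProduct, vandermonde_apply, Pi.single_apply] using this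
  have hlo : (fun s : ℝ => ∑ j, ∑ k, c j * c k * ((1 + s * (u j * u k)) ^ α -
      ∑ i ∈ Finset.range (K + 1), Ring.choose α i * (s * (u j * u k)) ^ i))
      =o[𝓝[>] 0] fun s => s ^ K :=
    Asymptotics.IsLittleO.fun_sum fun j _ => Asymptotics.IsLittleO.fun_sum fun k _ =>
      (jain_taylor α K (u j * u k)).const_mul_left _
  have heq : ∀ s : ℝ, ∑ j, ∑ k, c j * c k * 
      ∑ i ∈ Finset.range (K + 1), Ring.choose α i * (s * (u j * u k)) ^ i = Ring.choose α K * s ^ K := by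
    intro s
    calc _ = ∑ i ∈ Finset.range (K + 1), Ring.choose α i * s ^ i *
          ((∑ j, c j * u j ^ i) * (∑ j, c j * u j ^ i)) := by
          simp_rw [Finset.sum_mul_sum]
          simp_rw [Finset.mul_sum]
          rw [Finset.sum_comm]
          conv_rhs => rw [Finset.sum_comm]
          rw [Finset.sum_comm]
          refine Finset.sum_congr rfl fun j _ => ?_
          rw [Finset.sum_comm]
          refine Finset.sum_congr rfl fun i _ => Finset.sum_congr rfl fun k _ => ?_
          simp only [mul_pow]
          ring
      _ = _ := by
          rw [Finset.sum_range_succ, Finset.sum_eq_zero, hc' K (by omega)]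
          · simp
          · intro i hi
            have := Finset.mem_range.1 hi
            rw [hc' i (by omega), if_neg (by omega)]; simp
  have hQ : ∀ s : ℝ, 0 < s → 0 ≤ ∑ j, ∑ k, c j * c k * (1 + s * (u j * u k)) ^ α := by
    intro s hs
    have := (posSemidef_iff_dotProduct_mulVec.1 (h s hs)).2 c
    simp only [dotProduct, mulVec, Matrix.of_apply, Finset.mul_sum] at this
    refine this.trans_eq ?_
    refine Finset.sum_congr rfl fun j _ => Finset.sum_congr rfl fun k _ => ?_
    simp; ring
  have ht := hlo.tendsto_div_nhds_zero.add_const (Ring.choose α K)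
  rw [zero_add] at ht
  refine ge_of_tendsto ht ?_
  filter_upwards [self_mem_nhdsWithin] with s hs
  have hs' : 0 < s ^ K := pow_pos hs K
  have h1 := hQ s hs
  simp only [mul_sub, Finset.sum_sub_distrib]
  rw [heq, div_add' _ _ _ hs'.ne']
  apply div_nonneg _ hs'.le
  linarith

/-- Jain's theorem: for `N ≥ 2` and `u ∈ (0,∞)^N` with pairwise distinct
entries, the entrywise power `[(1 + u_j u_k)^α]` is positive semidefinite iff
`α` is a non-negative integer or `α ≥ N − 2`. -/
theorem stmt13 (N : ℕ) (hN : 2 ≤ N) (u : Fin N → ℝ) (hu : ∀ j, 0 < u j)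
    (huinj : Function.Injective u) (α : ℝ) :
    (Matrix.of fun j k : Fin N => (1 + u j * u k) ^ α).PosSemidef ↔
      ((∃ m : ℕ, α = (m : ℝ)) ∨ (N : ℝ) - 2 ≤ α) := by
  constructor
  · intro h
    by_contra! hcon
    obtain ⟨hm, hlt⟩ := hcon
    obtain ⟨K, hK, hneg⟩ := jain_neg α N hN hm hlt
    refine absurd (jain_limit N u huinj α K hK fun s hs => ?_) (not_le.2 hneg)
    have : PreconnectedSpace (Set.Ioi (0 : ℝ)) := Subtype.preconnectedSpace isPreconnected_Ioi
    refine jain_clopen (T := Set.Ioi (0 : ℝ)) N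
      (fun s => Matrix.of fun j k : Fin N => (1 + (s : ℝ) * (u j * u k)) ^ α) ?_ ?_ ?_
      ⟨1, Set.mem_Ioi.2 one_pos⟩ (by simpa using h) ⟨s, hs⟩
    · refine continuous_matrix fun j k => ?_
      simp only [Matrix.of_apply]
      refine Continuous.rpow_const (by fun_prop) fun s => Or.inl ?_
      have := mul_pos s.2 (mul_pos (hu j) (hu k)); linarith
    · intro t
      ext j k
      simp [mul_comm]
    · intro t c hc
      refine jain_nonsing N u hu huinj c α (fun i _ => hm i) t t.2 fun k => ?_
      simpa [mulVec, dotProduct] using congrFun hc k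
  · rintro (⟨m, rfl⟩ | hle)
    · exact jain_nat N u m
    · rcases hle.eq_or_lt with heq | hlt
      · have : α = ((N - 2 : ℕ) : ℝ) := by rw [← heq]; push_cast [hN]; ring
        rw [this]
        exact jain_nat N u _
      · have : PreconnectedSpace (Set.Ioi ((N : ℝ) - 2)) := Subtype.preconnectedSpace isPreconnected_Ioi
        refine jain_clopen (T := Set.Ioi ((N : ℝ) - 2)) N
          (fun a => Matrix.of fun j k : Fin N => (1 + (u j * u k)) ^ (a : ℝ)) ?_ ?_ ?_
          ⟨(N : ℝ), by simp⟩ (jain_nat N u N) ⟨α, hlt⟩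
        · refine continuous_matrix fun j k => ?_
          simp only [Matrix.of_apply]
          refine Continuous.rpow continuous_const continuous_subtype_val fun s => Or.inl ?_
          have := mul_pos (hu j) (hu k); linarith
        · intro t
          ext j k
          simp [mul_comm]
        · intro t c hc
          refine jain_nonsing N u hu huinj c t (fun i hi h => ?_) 1 one_pos fun k => ?_
          · have h1 := t.2
            rw [Set.mem_Ioi, h] at h1
            have : (i : ℝ) + 2 ≤ N := by exact_mod_cast hi
            linarith
          · simpa [mulVec, dotProduct] using congrFun hc k
end
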